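/- Let q be a prime power and S a surface of degree d in P^3 over F_q without F_q-plane components, with 2 ≤ d ≤ q+1 and N_q(S) = (d-1)q^2 + dq + 1. Then for every F_q-plane H, the section S ∩ H is either (1) a planar F_q-pencil of degree d, or (2) a plane curve of degree d without F_q-line components having exactly (d-1)q + 1 F_q-points. Moreover, the number of F_q-planes of type (1) is N_q(S) and the number of F_q-planes of type (2) is θ_q(3) − N_q(S), where θ_q(3) = q^3 + q^2 + q + 1. -/

import Mathlib

open MvPolynomial

variable {K : Type} [Field K]

/-- The linear form `∑ aᵢ Xᵢ` as a multivariate polynomial. -/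
noncomputable def linForm {n : ℕ} (a : Fin n → K) : MvPolynomial (Fin n) K :=
  ∑ i, C (a i) * X i

/-- The linear form `v ↦ ∑ aᵢ vᵢ` as a linear map. -/
noncomputable def linMap {n : ℕ} (a : Fin n → K) : (Fin n → K) →ₗ[K] K :=
  ∑ i, a i • LinearMap.proj i

/-- Substitution `F(M·X)` of a linear change of variables into `F`. -/
noncomputable def substLin {n : ℕ} (M : Matrix (Fin n) (Fin n) K)
    (F : MvPolynomial (Fin n) K) : MvPolynomial (Fin n) K :=
  MvPolynomial.aeval (fun i => ∑ j, C (M i j) * X j) F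

/-- Projective equivalence over `K` of two forms. -/
def ProjEquiv {n : ℕ} (F G : MvPolynomial (Fin n) K) : Prop :=
  ∃ M : Matrix (Fin n) (Fin n) K, IsUnit M.det ∧
    ∃ c : K, c ≠ 0 ∧ substLin M F = C c * G

/-- An `F_q`-line in `P^3` (resp. `P^2`), as a 2-dimensional linear subspace. -/
def IsLine {n : ℕ} (W : Submodule K (Fin n → K)) : Prop := Module.finrank K W = 2

/-- An `F_q`-plane in `P^3`, as a 3-dimensional linear subspace. -/
def IsPlane (W : Submodule K (Fin 4 → K)) : Prop := Module.finrank K W = 3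

/-- The section `S ∩ H` of the surface `S = {F = 0}` with the plane `H` given by the
subspace `W` is a planar `F_q`-pencil of degree `d` with vertex `P`: modulo the linear
form defining `H`, `F` is a nonzero scalar times a product of `d` linear forms over `F_q`
cutting out `d` pairwise distinct lines of `H`, all passing through the point `P`. -/
def IsPencil (F : MvPolynomial (Fin 4) K) (d : ℕ)
    (W : Submodule K (Fin 4 → K)) (P : Projectivization K (Fin 4 → K)) : Prop :=
  ∃ (a : Fin 4 → K) (m : Fin d → Fin 4 → K) (c : K) (g : MvPolynomial (Fin 4) K),
    a ≠ 0 ∧ W = LinearMap.ker (linMap a) ∧ c ≠ 0 ∧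
    F = C c * (∏ i, linForm (m i)) + linForm a * g ∧
    (∀ i, IsLine (LinearMap.ker (linMap a) ⊓ LinearMap.ker (linMap (m i)))) ∧
    (∀ i j, i ≠ j →
      LinearMap.ker (linMap a) ⊓ LinearMap.ker (linMap (m i)) ≠
      LinearMap.ker (linMap a) ⊓ LinearMap.ker (linMap (m j))) ∧
    P.rep ∈ W ∧ (∀ i, linMap (m i) P.rep = 0)

/-- The restriction of `F` to the plane `H` given by the subspace `W` has a linear
factor over `F_q` (i.e. the section `S ∩ H` has an `F_q`-line component). -/
def SectionHasLineComp (F : MvPolynomial (Fin 4) K)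
    (W : Submodule K (Fin 4 → K)) : Prop :=
  ∃ (a b : Fin 4 → K) (h g : MvPolynomial (Fin 4) K),
    a ≠ 0 ∧ W = LinearMap.ker (linMap a) ∧
    IsLine (LinearMap.ker (linMap a) ⊓ LinearMap.ker (linMap b)) ∧
    F = linForm b * h + linForm a * g

section Substitution

variable {k l n : ℕ}

/-- The pull-back of `F` along the linear map `x ↦ x ᵥ* B`. -/
noncomputable def pullback (B : Matrix (Fin k) (Fin n) K) (F : MvPolynomial (Fin n) K) :
    MvPolynomial (Fin k) K :=
  aeval (fun i => linForm (fun j => B j i)) F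

/-- The univariate polynomial `F(Q + tv)`. -/
noncomputable def alongLine (F : MvPolynomial (Fin n) K) (Q v : Fin n → K) : Polynomial K :=
  aeval (fun i => Polynomial.C (Q i) + Polynomial.C (v i) * Polynomial.X) F

lemma linMap_apply (a x : Fin n → K) : linMap a x = a ⬝ᵥ x := by
  simp [linMap, dotProduct]

lemma eval_linForm (a x : Fin n → K) : eval x (linForm a) = a ⬝ᵥ x := by
  simp [linForm, dotProduct]

lemma aeval_linForm {A : Type*} [CommSemiring A] [Algebra K A] (a : Fin n → K) (x : Fin n → A) :
    aeval x (linForm a) = ∑ i, algebraMap K A (a i) * x i := by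
  simp [linForm]

lemma eval_pullback (B : Matrix (Fin k) (Fin n) K) (F : MvPolynomial (Fin n) K) (x : Fin k → K) :
    eval x (pullback B F) = eval (Matrix.vecMul x B) F := by
  rw [pullback, ← MvPolynomial.coe_aeval_eq_eval, ← MvPolynomial.coe_aeval_eq_eval]
  simp only [RingHom.coe_coe]
  rw [← AlgHom.comp_apply, comp_aeval]
  congr 2
  ext i
  rw [aeval_linForm]
  simp [Matrix.vecMul, dotProduct, mul_comm]

lemma pullback_mul (B : Matrix (Fin k) (Fin n) K) (F G : MvPolynomial (Fin n) K) :
    pullback B (F * G) = pullback B F * pullback B G := map_mul _ _ _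

lemma pullback_linForm (B : Matrix (Fin k) (Fin n) K) (a : Fin n → K) :
    pullback B (linForm a) = linForm (Matrix.mulVec B a) := by
  rw [pullback, aeval_linForm]
  simp only [linForm, Finset.mul_sum, algebraMap_eq, Matrix.mulVec, dotProduct, map_sum,
    Finset.sum_mul, map_mul]
  rw [Finset.sum_comm]
  refine Finset.sum_congr rfl fun i _ => Finset.sum_congr rfl fun j _ => by ring

lemma pullback_C (B : Matrix (Fin k) (Fin n) K) (c : K) :
    pullback B (C c) = C c := by
  simp [pullback]

lemma pullback_pullback (A : Matrix (Fin l) (Fin k) K) (B : Matrix (Fin k) (Fin n) K)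
    (F : MvPolynomial (Fin n) K) : pullback A (pullback B F) = pullback (A * B) F := by
  conv_lhs => rw [pullback, pullback]
  rw [← AlgHom.comp_apply, comp_aeval, pullback]
  congr 2
  ext1 i
  change pullback A _ = _
  rw [pullback_linForm]
  rfl

lemma linForm_isHomogeneous (a : Fin n → K) : (linForm a).IsHomogeneous 1 := by
  refine IsHomogeneous.sum _ _ _ fun i _ => ?_
  simpa using (isHomogeneous_C _ (a i)).mul (isHomogeneous_X K i)

lemma pullback_isHomogeneous {d : ℕ} (B : Matrix (Fin k) (Fin n) K) {F : MvPolynomial (Fin n) K}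
    (hF : F.IsHomogeneous d) : (pullback B F).IsHomogeneous d := by
  have := hF.aeval (fun i => linForm (fun j => B j i))
    (fun i => linForm_isHomogeneous (fun j => B j i))
  rwa [one_mul] at this

lemma linForm_dvd_of_pullback_eq_zero (a r : Fin n → K) (har : a ⬝ᵥ r = 1)
    (B : Matrix (Fin k) (Fin n) K) (hB : ∀ x, a ⬝ᵥ x = 0 → ∃ y, Matrix.vecMul y B = x)
    {G : MvPolynomial (Fin n) K} (hG : pullback B G = 0) : linForm a ∣ G := by
  have h1 : ∀ i : Fin n, ∃ y, Matrix.vecMul y B = Pi.single i 1 - a i • r := by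
    intro i
    apply hB
    simp [dotProduct_sub, har]
  choose A hA using h1
  have h2 : pullback (Matrix.of A * B) G = 0 := by
    rw [← pullback_pullback, hG]; simp [pullback]
  rw [← Ideal.mem_span_singleton, ← Ideal.Quotient.eq_zero_iff_mem]
  have h3 : (Ideal.Quotient.mkₐ K (Ideal.span {linForm a})) =
      (Ideal.Quotient.mkₐ K (Ideal.span {linForm a})).comp
        (aeval (fun i => linForm (fun j => (Matrix.of A * B) j i))) := by
    apply MvPolynomial.algHom_ext
    intro i
    simp only [Ideal.Quotient.mkₐ_eq_mk, AlgHom.comp_apply, aeval_X]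
    rw [Ideal.Quotient.eq, Ideal.mem_span_singleton]
    refine ⟨C (r i), ?_⟩
    have h4 : ∀ j, (Matrix.of A * B) j i = (if i = j then 1 else 0) - a j * r i := by
      intro j
      have := congrFun (hA j) i
      simp only [Matrix.vecMul, Pi.sub_apply, Pi.smul_apply, smul_eq_mul, Pi.single_apply] at this
      exact this
    simp only [linForm, h4, map_sub, map_mul, sub_mul, Finset.sum_sub_distrib, Finset.sum_mul]
    simp only [apply_ite, map_one, map_zero]
    simp [mul_right_comm]
  have h5 := DFunLike.congr_fun h3 G
  rw [AlgHom.comp_apply] at h5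
  have h6 : aeval (fun i => linForm (fun j => (Matrix.of A * B) j i)) G = 0 := h2
  rw [h6, map_zero] at h5
  exact h5

lemma eval_alongLine (F : MvPolynomial (Fin n) K) (Q v : Fin n → K) (s : K) :
    (alongLine F Q v).eval s = eval (Q + s • v) F := by
  rw [alongLine, ← Polynomial.coe_aeval_eq_eval, ← MvPolynomial.coe_aeval_eq_eval]
  simp only [RingHom.coe_coe]
  rw [← AlgHom.comp_apply, comp_aeval]
  congr 2
  ext i
  simp only [map_add, map_mul, Polynomial.aeval_C, Polynomial.aeval_X, Pi.add_apply,
    Pi.smul_apply, smul_eq_mul, Algebra.algebraMap_self, RingHom.id_apply]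
  ring

lemma alongLine_mul (F G : MvPolynomial (Fin n) K) (Q v : Fin n → K) :
    alongLine (F * G) Q v = alongLine F Q v * alongLine G Q v := map_mul _ _ _

lemma natDegree_alongLine_le (F : MvPolynomial (Fin n) K) (Q v : Fin n → K) :
    (alongLine F Q v).natDegree ≤ F.totalDegree := by
  have := aeval_natDegree_le F le_rfl
    (fun i => Polynomial.C (Q i) + Polynomial.C (v i) * Polynomial.X) (n := 1) (fun i => by compute_degree)
  simpa [alongLine] using this

lemma alongLine_pullback (B : Matrix (Fin k) (Fin n) K) (F : MvPolynomial (Fin n) K)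
    (Q v : Fin k → K) :
    alongLine (pullback B F) Q v = alongLine F (Matrix.vecMul Q B) (Matrix.vecMul v B) := by
  rw [alongLine, pullback, ← AlgHom.comp_apply, comp_aeval, alongLine]
  congr 2
  ext1 i
  rw [aeval_linForm]
  simp only [Matrix.vecMul, dotProduct, map_sum, Finset.sum_mul, ← Finset.sum_add_distrib,
    map_mul, Polynomial.algebraMap_eq]
  refine Finset.sum_congr rfl fun j _ => by ring

/-- The differential of `F` at `P`. -/
noncomputable def differential (F : MvPolynomial (Fin n) K) (P : Fin n → K) :
    (Fin n → K) →ₗ[K] K :=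
  linMap (fun i => eval P (pderiv i F))

lemma differential_apply (F : MvPolynomial (Fin n) K) (P v : Fin n → K) :
    differential F P v = ∑ i, eval P (pderiv i F) * v i := by
  simp [differential, linMap]

lemma differential_mul (F G : MvPolynomial (Fin n) K) (P v : Fin n → K) :
    differential (F * G) P v = differential F P v * eval P G + eval P F * differential G P v := by
  simp only [differential_apply, Derivation.leibniz, smul_eq_mul, map_add, map_mul,
    Finset.sum_mul, Finset.mul_sum, ← Finset.sum_add_distrib]
  refine Finset.sum_congr rfl fun j _ => by ring

lemma differential_add (F G : MvPolynomial (Fin n) K) (P v : Fin n → K) :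
    differential (F + G) P v = differential F P v + differential G P v := by
  simp [differential_apply, add_mul, Finset.sum_add_distrib]

lemma differential_C (c : K) (P v : Fin n → K) : differential (C c) P v = 0 := by
  simp [differential_apply]

lemma differential_linForm (a P v : Fin n → K) : differential (linForm a) P v = a ⬝ᵥ v := by
  simp only [differential_apply, dotProduct]
  refine Finset.sum_congr rfl fun j _ => ?_
  congr 1
  simp [linForm, pderiv_X, Pi.single_apply]

lemma differential_eq_eval_derivative (F : MvPolynomial (Fin n) K) (P v : Fin n → K) :
    differential F P v = (Polynomial.derivative (alongLine F P v)).eval 0 := by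
  induction F using MvPolynomial.induction_on with
  | C c => simp [differential_C, alongLine]
  | add F G hF hG => rw [differential_add, hF, hG]; simp [alongLine]
  | mul_X F i hF =>
    have h0 : (alongLine F P v).eval 0 = eval P F := by simp [eval_alongLine]
    rw [differential_mul, hF, alongLine_mul]
    have h1 : alongLine (X i) P v = Polynomial.C (P i) + Polynomial.C (v i) * Polynomial.X := by
      simp [alongLine]
    have h2 : differential (X i) P v = v i := by
      simp [differential_apply, pderiv_X, Pi.single_apply]
    rw [h1, h2]
    simp [h0]

lemma aeval_mul_of_isHomogeneous {A : Type*} [CommRing A] [Algebra K A] {d : ℕ}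
    {f : MvPolynomial (Fin n) K} (hf : f.IsHomogeneous d) (s : A) (x : Fin n → A) :
    aeval (fun i => s * x i) f = s ^ d * aeval x f := by
  simp only [aeval_def, eval₂_eq', Finset.mul_sum, mul_pow, Finset.prod_mul_distrib,
    Finset.prod_pow_eq_pow_sum]
  refine Finset.sum_congr rfl fun m hm => ?_
  have := hf.degree_eq_sum_deg_support hm
  rw [← Finsupp.sum_fintype m (fun _ x => x) (fun _ => rfl), Finsupp.sum, ← this]
  ring

lemma eval_smul_of_isHomogeneous {d : ℕ} {f : MvPolynomial (Fin n) K} (hf : f.IsHomogeneous d)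
    (s : K) (x : Fin n → K) : eval (s • x) f = s ^ d * eval x f :=
  aeval_mul_of_isHomogeneous hf s x

lemma eq_zero_of_eval_one {d : ℕ} {f : MvPolynomial (Fin 1) K} (hf : f.IsHomogeneous d)
    (h : eval 1 f = 0) : f = 0 := by
  have h1 := aeval_mul_of_isHomogeneous hf (X 0 : MvPolynomial (Fin 1) K) (fun _ => 1)
  have h2 : (fun i : Fin 1 => (X 0 : MvPolynomial (Fin 1) K) * 1) = X := by
    ext1 i; rw [Subsingleton.elim i 0, mul_one]
  have h3 : aeval (fun _ => (1 : MvPolynomial (Fin 1) K)) f = C (eval 1 f) := by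
    have := MvPolynomial.aeval_algebraMap_apply (MvPolynomial (Fin 1) K) (1 : Fin 1 → K) f
    simpa [Function.comp_def] using this
  rw [h2, aeval_X_left_apply, h3, h, map_zero, mul_zero] at h1
  exact h1

lemma aeval_eq_zero_of_alongLine {L : Type*} [Field L] [Algebra K L] {d : ℕ}
    {F : MvPolynomial (Fin n) K} (hF : F.IsHomogeneous d) {Q v : Fin n → K}
    (h : alongLine F Q v = 0) (s t : L) (hs : s ≠ 0) :
    aeval (fun i => algebraMap K L (v i) * t + algebraMap K L (Q i) * s) F = 0 := by
  have h1 : aeval (fun i => algebraMap K L (Q i) + algebraMap K L (v i) * (t / s)) F = 0 := by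
    have h2 := congrArg (Polynomial.aeval (t / s)) h
    rw [alongLine, ← AlgHom.comp_apply, comp_aeval, map_zero] at h2
    simpa [Function.comp_def] using h2
  have h3 := aeval_mul_of_isHomogeneous hF s
    (fun i => algebraMap K L (Q i) + algebraMap K L (v i) * (t / s))
  rw [h1, mul_zero] at h3
  rw [← h3]
  congr 2
  ext1 i
  field_simp
  ring

lemma pullback_eq_zero_of_alongLine {d : ℕ} {F : MvPolynomial (Fin n) K} (hF : F.IsHomogeneous d)
    {Q v : Fin n → K} (h : alongLine F Q v = 0) : pullback (Matrix.of ![v, Q]) F = 0 := by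
  have h1 := aeval_eq_zero_of_alongLine hF h
    (algebraMap (MvPolynomial (Fin 2) K) (FractionRing (MvPolynomial (Fin 2) K)) (X 1))
    (algebraMap (MvPolynomial (Fin 2) K) (FractionRing (MvPolynomial (Fin 2) K)) (X 0)) (by simp)
  apply IsFractionRing.injective (MvPolynomial (Fin 2) K) (FractionRing (MvPolynomial (Fin 2) K))
  rw [map_zero, ← h1, pullback, ← aeval_algebraMap_apply]
  congr 2
  ext1 i
  simp only [linForm, Fin.sum_univ_two, Function.comp_apply, map_add, map_mul, Matrix.of_apply, Matrix.cons_val_zero,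
    Matrix.cons_val_one, IsScalarTower.algebraMap_apply K (MvPolynomial (Fin 2) K)
      (FractionRing (MvPolynomial (Fin 2) K)), algebraMap_eq]

lemma eval_eq_zero_of_pullback {F : MvPolynomial (Fin n) K} {B : Matrix (Fin k) (Fin n) K}
    (h : pullback B F = 0) (x : Fin k → K) : eval (Matrix.vecMul x B) F = 0 := by
  rw [← eval_pullback, h, map_zero]

lemma natDegree_alongLine_le_of_eval_eq_zero {e : ℕ} {F : MvPolynomial (Fin n) K}
    (hF : F.IsHomogeneous (e + 1)) (Q v : Fin n → K) (hv : eval v F = 0) :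
    (alongLine F Q v).natDegree ≤ e := by
  have h1 : alongLine F Q v = alongLine (pullback (Matrix.of ![v, Q]) F) ![0, 1] ![1, 0] := by
    rw [alongLine_pullback]; simp
  have h2 : linForm ![0, 1] ∣ pullback (Matrix.of ![v, Q]) F := by
    apply linForm_dvd_of_pullback_eq_zero _ ![0, 1] (by simp) (Matrix.of ![![1, 0]])
    · intro x hx
      refine ⟨fun _ => x 0, ?_⟩
      simp [dotProduct] at hx
      ext i; fin_cases i <;> simp [Matrix.vecMul, dotProduct, hx]
    · apply eq_zero_of_eval_one (pullback_isHomogeneous _ (pullback_isHomogeneous _ hF))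
      rw [eval_pullback, eval_pullback]
      have : Matrix.vecMul (Matrix.vecMul 1 (Matrix.of ![![1, 0]])) (Matrix.of ![v, Q]) = v := by
        ext i; simp [Matrix.vecMul, dotProduct]
      rw [this, hv]
  obtain ⟨g, hg⟩ := h2
  have h3 : alongLine F Q v = alongLine g ![0, 1] ![1, 0] := by
    rw [h1, hg, alongLine_mul]
    simp [alongLine, linForm]
  by_cases hz : pullback (Matrix.of ![v, Q]) F = 0
  · rw [h1, hz]; simp [alongLine]
  have hl : linForm ![(0 : K), 1] ≠ 0 := by rintro h; rw [h, zero_mul] at hg; exact hz hg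
  have hg0 : g ≠ 0 := by rintro h; rw [h, mul_zero] at hg; exact hz hg
  have h4 := (pullback_isHomogeneous (Matrix.of ![v, Q]) hF).totalDegree hz
  rw [hg, totalDegree_mul_of_isDomain hl hg0, (linForm_isHomogeneous _).totalDegree hl] at h4
  rw [h3]
  exact (natDegree_alongLine_le _ _ _).trans (by omega)

end Substitution

section PlaneCurve

lemma linForm_ne_zero {n : ℕ} {a : Fin n → K} (i : Fin n) (h : a i ≠ 0) : linForm a ≠ 0 := by
  intro h0
  have := congrArg (eval (Pi.single i 1)) h0
  rw [eval_linForm] at this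
  simp [h] at this

lemma X_two_dvd_of_pullback {f : MvPolynomial (Fin 3) K}
    (h : pullback (Matrix.of ![![1, 0, 0], ![0, 1, 0]]) f = 0) : linForm ![0, 0, 1] ∣ f := by
  refine linForm_dvd_of_pullback_eq_zero _ ![0, 0, 1] (by simp) _ (fun x hx => ?_) h
  refine ⟨![x 0, x 1], ?_⟩
  simp [dotProduct, Fin.sum_univ_three] at hx
  ext i; fin_cases i <;> simp [hx]

lemma prod_linForm_dvd (S : Finset K) (f : MvPolynomial (Fin 3) K)
    (h : ∀ γ ∈ S, pullback (Matrix.of ![![1, 0, 0], ![0, γ, 1]]) f = 0) :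
    (∏ γ ∈ S, linForm ![0, 1, -γ]) ∣ f := by
  classical
  induction S using Finset.induction_on generalizing f with
  | empty => simp
  | insert γ S hγ ih =>
    rw [Finset.prod_insert hγ]
    have h1 : linForm ![0, 1, -γ] ∣ f := by
      refine linForm_dvd_of_pullback_eq_zero _ ![0, 1, 0] (by simp) _ (fun x hx => ?_)
        (h γ (Finset.mem_insert_self _ _))
      refine ⟨![x 0, x 2], ?_⟩
      simp [dotProduct, Fin.sum_univ_three] at hx
      ext i; fin_cases i <;> simp
      linear_combination -hx
    obtain ⟨g, rfl⟩ := h1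
    refine mul_dvd_mul_left _ (ih g fun δ hδ => ?_)
    have h2 := h δ (Finset.mem_insert_of_mem hδ)
    rw [pullback_mul, pullback_linForm] at h2
    refine (mul_eq_zero.mp h2).resolve_left (linForm_ne_zero 1 ?_)
    have : δ ≠ γ := fun h => hγ (h ▸ hδ)
    simpa [Matrix.mulVec, dotProduct, Fin.sum_univ_three, ← sub_eq_add_neg, sub_eq_zero] using this

lemma totalDegree_prod_linForm (S : Finset K) :
    (∏ γ ∈ S, linForm ![0, 1, -γ]).totalDegree = S.card := by
  have h : (∏ γ ∈ S, linForm ![0, 1, -γ]).IsHomogeneous (∑ γ ∈ S, 1) :=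
    IsHomogeneous.prod _ _ _ fun γ _ => linForm_isHomogeneous _
  rw [h.totalDegree (Finset.prod_ne_zero_iff.mpr fun γ _ => linForm_ne_zero 1 (by simp))]
  simp

variable [Fintype K] [DecidableEq K]

lemma card_filter_eval_le {p : Polynomial K} (hp : p ≠ 0) :
    (Finset.univ.filter fun s => p.eval s = 0).card ≤ p.natDegree := by
  refine le_trans (Finset.card_le_card ?_) (p.roots.toFinset_card_le.trans p.card_roots')
  intro s hs
  simpa [hp] using hs

/-- A plane curve of degree `e + 1` containing the line at infinity `X 2 = 0` and exactly `k`
affine lines through the point `(1 : 0 : 0)` has at most `e q - k (e - k)` affine points. -/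
lemma affine_zeros_bound {e : ℕ} {f : MvPolynomial (Fin 3) K} (hf : f.IsHomogeneous (e + 1))
    (hf0 : f ≠ 0) (hinf : linForm ![0, 0, 1] ∣ f) (Γ : Finset K)
    (hΓ : ∀ γ, γ ∈ Γ ↔ alongLine f ![0, γ, 1] ![1, 0, 0] = 0) :
    ∃ h, f = linForm ![0, 0, 1] * ((∏ γ ∈ Γ, linForm ![0, 1, -γ]) * h) ∧
      Γ.card + h.totalDegree = e ∧
      (Finset.univ.filter fun p : K × K => eval ![p.1, p.2, 1] f = 0).card +
        Γ.card * (e - Γ.card) ≤ e * Fintype.card K := by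
  obtain ⟨f', rfl⟩ := hinf
  have hz : linForm ![(0 : K), 0, 1] ≠ 0 := linForm_ne_zero 2 (by simp)
  have hf'0 : f' ≠ 0 := right_ne_zero_of_mul hf0
  have hdvd : (∏ γ ∈ Γ, linForm ![0, 1, -γ]) ∣ f' := by
    refine prod_linForm_dvd Γ f' fun γ hγ => ?_
    have h1 := pullback_eq_zero_of_alongLine hf ((hΓ γ).mp hγ)
    rw [pullback_mul, pullback_linForm] at h1
    refine (mul_eq_zero.mp h1).resolve_left (linForm_ne_zero 1 ?_)
    simp [Matrix.mulVec, dotProduct, Fin.sum_univ_three]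
  obtain ⟨h, rfl⟩ := hdvd
  have hp0 := left_ne_zero_of_mul hf'0
  have hh0 := right_ne_zero_of_mul hf'0
  have hdeg : Γ.card + h.totalDegree = e := by
    have := hf.totalDegree hf0
    rw [totalDegree_mul_of_isDomain hz hf'0, totalDegree_mul_of_isDomain hp0 hh0,
      totalDegree_prod_linForm, (linForm_isHomogeneous _).totalDegree hz] at this
    omega
  refine ⟨h, rfl, hdeg, ?_⟩
  set F := linForm ![(0 : K), 0, 1] * ((∏ γ ∈ Γ, linForm ![0, 1, -γ]) * h) with hF
  have hcard : (Finset.univ.filter fun p : K × K => eval ![p.1, p.2, 1] F = 0).card =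
      ∑ γ, (Finset.univ.filter fun x : K => eval ![x, γ, 1] F = 0).card := by
    simp only [Finset.card_filter]
    rw [← Finset.univ_product_univ, Finset.sum_product_right]
  have hle : ∀ γ, (Finset.univ.filter fun x : K => eval ![x, γ, 1] F = 0).card ≤
      if γ ∈ Γ then Fintype.card K else e - Γ.card := by
    intro γ
    split_ifs with hγ
    · exact Finset.card_le_univ _
    · have h1 : alongLine h ![0, γ, 1] ![1, 0, 0] ≠ 0 := by
        intro h0
        apply hγ
        rw [hΓ, hF, alongLine_mul, alongLine_mul, h0, mul_zero, mul_zero]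
      refine le_trans (Finset.card_le_card ?_) ((card_filter_eval_le h1).trans
        ((natDegree_alongLine_le _ _ _).trans (by omega)))
      intro x hx
      simp only [Finset.mem_filter, Finset.mem_univ, true_and] at hx ⊢
      rw [eval_alongLine]
      have h2 : ![0, γ, 1] + x • ![1, 0, 0] = ![x, γ, 1] := by
        ext i; fin_cases i <;> simp
      rw [h2]
      rw [hF, map_mul, map_mul, map_prod, eval_linForm] at hx
      simp only [eval_linForm] at hx
      simp only [mul_eq_zero, Finset.prod_eq_zero_iff] at hx
      rcases hx with hx | ⟨δ, hδ, hx⟩ | hx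
      · simp [dotProduct, Fin.sum_univ_three] at hx
      · simp [dotProduct, Fin.sum_univ_three, ← sub_eq_add_neg, sub_eq_zero] at hx
        exact absurd (hx ▸ hδ) hγ
      · exact hx
  have hsum := Finset.sum_le_sum fun γ (_ : γ ∈ Finset.univ) => hle γ
  rw [← hcard, Finset.sum_ite, Finset.sum_const, Finset.sum_const] at hsum
  have hc1 : (Finset.univ.filter fun γ => γ ∈ Γ) = Γ := by ext; simp
  have hc2 : (Finset.univ.filter fun γ => γ ∉ Γ) = Γᶜ := by ext; simp
  rw [hc1, hc2, Finset.card_compl, smul_eq_mul, smul_eq_mul] at hsum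
  have hkq := Finset.card_le_univ Γ
  have hke : Γ.card ≤ e := by omega
  obtain ⟨a, ha⟩ := Nat.exists_eq_add_of_le hkq
  obtain ⟨b, rfl⟩ := Nat.exists_eq_add_of_le hke
  rw [ha] at hsum ⊢
  simp only [Nat.add_sub_cancel_left] at hsum ⊢
  nlinarith

lemma card_filter_perm {A G : Type*} [Fintype A] (S : Finset G) (σ : A → Equiv.Perm G)
    (R : G → Prop) [DecidablePred R] (hS : ∀ a w, σ a w ∈ S ↔ w ∈ S) :
    ∑ w ∈ S, (Finset.univ.filter fun a => R (σ a w)).card =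
      Fintype.card A * (S.filter R).card := by
  simp only [Finset.card_filter]
  rw [Finset.sum_comm]
  have : ∀ a ∈ Finset.univ, (∑ w ∈ S, if R (σ a w) then 1 else 0) = ∑ w ∈ S, if R w then 1 else 0 := by
    intro a _
    exact Finset.sum_equiv (σ a) (fun w => (hS a w).symm) (fun w _ => rfl)
  rw [Finset.sum_congr rfl this, Finset.sum_const, Finset.card_univ, smul_eq_mul]

lemma eq_zero_of_roots_of_derivative {p : Polynomial K} (hdeg : p.natDegree ≤ Fintype.card K)
    (hroots : ∀ s, p.eval s = 0) (hder : p.derivative.eval 0 = 0) : p = 0 := by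
  obtain ⟨g, rfl⟩ : Polynomial.X ∣ p := by
    rw [Polynomial.X_dvd_iff, Polynomial.coeff_zero_eq_eval_zero, hroots]
  by_cases hg : g = 0
  · simp [hg]
  exfalso
  apply hg
  rw [Polynomial.natDegree_X_mul hg] at hdeg
  refine Polynomial.eq_zero_of_natDegree_lt_card_of_eval_eq_zero g Function.injective_id
    (fun s => ?_) (by omega)
  by_cases hs : s = 0
  · simpa [hs] using hder
  · simpa [hs] using hroots s

/-- A plane curve of degree `e + 1` containing the line at infinity `X 2 = 0` and having `e q`
affine points contains another line. -/
lemma exists_affine_line {e : ℕ} (he1 : 1 ≤ e) (he : e ≤ Fintype.card K)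
    {f : MvPolynomial (Fin 3) K} (hf : f.IsHomogeneous (e + 1))
    (hf0 : f ≠ 0) (hinf : linForm ![0, 0, 1] ∣ f)
    (hcard : (Finset.univ.filter fun p : K × K => eval ![p.1, p.2, 1] f = 0).card =
      e * Fintype.card K) :
    ∃ p v : K × K, v ≠ 0 ∧ alongLine f ![p.1, p.2, 1] ![v.1, v.2, 0] = 0 := by
  obtain ⟨f', rfl⟩ := hinf
  have hz : linForm ![(0 : K), 0, 1] ≠ 0 := linForm_ne_zero 2 (by simp)
  have hf'0 : f' ≠ 0 := right_ne_zero_of_mul hf0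
  have hdeg : f'.totalDegree = e := by
    have := hf.totalDegree hf0
    rw [totalDegree_mul_of_isDomain hz hf'0, (linForm_isHomogeneous _).totalDegree hz] at this
    omega
  have hev : ∀ p : K × K, eval ![p.1, p.2, 1] (linForm ![0, 0, 1] * f') =
      eval ![p.1, p.2, 1] f' := by
    intro p
    rw [map_mul, eval_linForm]
    simp [dotProduct, Fin.sum_univ_three]
  simp only [hev] at hcard
  suffices h : ∃ p v : K × K, v ≠ 0 ∧ alongLine f' ![p.1, p.2, 1] ![v.1, v.2, 0] = 0 by
    obtain ⟨p, v, hv, h⟩ := h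
    exact ⟨p, v, hv, by rw [alongLine_mul, h, mul_zero]⟩
  have hadd : ∀ (p v : K × K) (s : K), ![p.1, p.2, 1] + s • ![v.1, v.2, 0] =
      ![(p + s • v).1, (p + s • v).2, 1] := by
    intro p v s
    ext i; fin_cases i <;> simp
  have hq : 1 < Fintype.card K := Fintype.one_lt_card
  rcases he.lt_or_eq with he | he
  · have hpos : 0 < (Finset.univ.filter fun p : K × K => eval ![p.1, p.2, 1] f' = 0).card := by
      rw [hcard]; positivity
    obtain ⟨p, hp⟩ := Finset.card_pos.mp hpos
    simp only [Finset.mem_filter, Finset.mem_univ, true_and] at hp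
    by_contra! hno
    have h1 := card_filter_perm (A := Kˣ) (Finset.univ.filter fun v : K × K => v ≠ 0)
      (fun s => MulAction.toPerm s)
      (fun v => eval ![(p + v).1, (p + v).2, 1] f' = 0) (by
        intro s w; simp [smul_eq_zero_iff_eq])
    have h2 : ∀ v ∈ (Finset.univ.filter fun v : K × K => v ≠ 0),
        (Finset.univ.filter fun s : Kˣ => eval ![(p + MulAction.toPerm s v).1,
          (p + MulAction.toPerm s v).2, 1] f' = 0).card ≤ e - 1 := by
      intro v hv
      simp only [Finset.mem_filter, Finset.mem_univ, true_and] at hv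
      have h3 := (card_filter_eval_le (hno p v hv)).trans (natDegree_alongLine_le _ _ _)
      rw [hdeg] at h3
      have h4 : ((Finset.univ.filter fun s : Kˣ => eval ![(p + MulAction.toPerm s v).1,
          (p + MulAction.toPerm s v).2, 1] f' = 0).map ⟨Units.val, Units.val_injective⟩).card <
          (Finset.univ.filter fun s =>
            (alongLine f' ![p.1, p.2, 1] ![v.1, v.2, 0]).eval s = 0).card := by
        apply Finset.card_lt_card
        rw [Finset.ssubset_iff_of_subset]
        · refine ⟨0, ?_, by simp⟩
          simpa [eval_alongLine] using hp
        · intro s hs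
          simp only [Finset.mem_map, Finset.mem_filter, Finset.mem_univ, true_and,
            Function.Embedding.coeFn_mk] at hs
          obtain ⟨u, hu, rfl⟩ := hs
          simp only [Finset.mem_filter, Finset.mem_univ, true_and, eval_alongLine, hadd]
          exact hu
      rw [Finset.card_map] at h4
      omega
    have h3 := Finset.sum_le_card_nsmul _ _ _ h2
    rw [h1, smul_eq_mul, Finset.filter_ne', Finset.card_erase_of_mem (Finset.mem_univ _),
      Finset.card_univ, Fintype.card_prod, Fintype.card_units] at h3
    have h4 : (Finset.univ.filter fun p : K × K => eval ![p.1, p.2, 1] f' = 0).card =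
        (Finset.univ.filter fun v : K × K => eval ![(p + v).1, (p + v).2, 1] f' = 0).card := by
      rw [eq_comm]
      apply Finset.card_bij (fun v _ => p + v)
      · intro v hv; simpa using hv
      · intro v _ w _ h; simpa using h
      · intro v hv
        refine ⟨v - p, ?_, by simp⟩
        simp only [Finset.mem_filter, Finset.mem_univ, true_and] at hv ⊢
        simpa using hv
    rw [hcard] at h4
    rw [Finset.filter_erase, Finset.card_erase_of_mem (by simpa using hp), ← h4] at h3
    obtain ⟨r, hr⟩ := Nat.exists_eq_add_of_le hq.le
    obtain ⟨b, rfl⟩ := Nat.exists_eq_add_of_le he1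
    have h5 : (1 + b) * Fintype.card K - 1 = b + r + b * r := by
      rw [hr, Nat.sub_eq_iff_eq_add (by nlinarith)]; ring
    have h6 : Fintype.card K * Fintype.card K - 1 = r * (r + 2) := by
      rw [hr, Nat.sub_eq_iff_eq_add (by nlinarith)]; ring
    rw [h5, h6, hr] at h3
    simp only [Nat.add_sub_cancel_left] at h3
    rw [mul_assoc] at h3
    have := Nat.le_of_mul_le_mul_left h3 (by omega)
    have : b < r := by omega
    nlinarith
  · have hall : ∀ p : K × K, eval ![p.1, p.2, 1] f' = 0 := by
      have := (Finset.card_eq_iff_eq_univ (Finset.univ.filter fun p : K × K =>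
        eval ![p.1, p.2, 1] f' = 0)).mp (by rw [hcard, he, Fintype.card_prod])
      intro p
      have h1 := Finset.mem_univ p
      rw [← this] at h1
      simpa using h1
    refine ⟨0, ?_⟩
    let D := differential f' ![0, 0, 1]
    have hv : ∃ v : K × K, v ≠ 0 ∧ D ![v.1, v.2, 0] = 0 := by
      by_cases h1 : D ![1, 0, 0] = 0
      · exact ⟨(1, 0), by simp, h1⟩
      · refine ⟨(- D ![0, 1, 0], D ![1, 0, 0]), by simp [h1], ?_⟩
        have : ![- D ![0, 1, 0], D ![1, 0, 0], 0] =
          (- D ![0, 1, 0]) • ![(1 : K), 0, 0] + D ![1, 0, 0] • ![(0 : K), 1, 0] := by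
          ext i; fin_cases i <;> simp
        simp only [this, map_add, map_smul, smul_eq_mul]
        ring
    obtain ⟨v, hv, hD⟩ := hv
    refine ⟨v, hv, eq_zero_of_roots_of_derivative
      ((natDegree_alongLine_le _ _ _).trans (by omega)) (fun s => ?_) ?_⟩
    · rw [eval_alongLine, hadd, hall]
    · rw [← differential_eq_eval_derivative]; exact hD

end PlaneCurve

section Planes

lemma mem_span_range_iff_vecMul {k n : ℕ} (B : Fin k → Fin n → K) (x : Fin n → K) :
    x ∈ Submodule.span K (Set.range B) ↔ ∃ y, Matrix.vecMul y (Matrix.of B) = x := by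
  rw [Submodule.mem_span_range_iff_exists_fun]
  simp only [Matrix.vecMul_eq_sum]
  rfl

lemma range_pair {α : Type*} (V U : α) : Set.range ![V, U] = {V, U} := by
  simp [Matrix.range_cons, Set.pair_comm]

lemma exists_eq_ker_linMap {W : Submodule K (Fin 4 → K)} (hW : IsPlane W) :
    ∃ a : Fin 4 → K, a ≠ 0 ∧ W = LinearMap.ker (linMap a) := by
  have hlt : W < ⊤ := by
    rw [lt_top_iff_ne_top]
    rintro rfl
    rw [IsPlane, finrank_top, Module.finrank_fin_fun] at hW
    omega
  obtain ⟨φ, hφ, hle⟩ := Submodule.exists_le_ker_of_lt_top W hlt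
  have hφa : φ = linMap (fun i => φ (Pi.single i 1)) := by
    ext i
    simp [linMap_apply]
  rw [hφa] at hle hφ
  refine ⟨_, ?_, Submodule.eq_of_le_of_finrank_eq hle ?_⟩
  · intro h
    rw [h] at hφ
    apply hφ
    ext; simp [linMap_apply]
  · have h1 := LinearMap.finrank_range_add_finrank_ker (linMap fun i => φ (Pi.single i 1))
    rw [LinearMap.range_eq_top.mpr (LinearMap.surjective_of_ne_zero hφ), finrank_top,
      Module.finrank_self, Module.finrank_fin_fun] at h1
    rw [IsPlane] at hW
    omega

lemma isPlane_ker {φ : (Fin 4 → K) →ₗ[K] K} (hφ : φ ≠ 0) : IsPlane (LinearMap.ker φ) := by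
  have h1 := LinearMap.finrank_range_add_finrank_ker φ
  rw [LinearMap.range_eq_top.mpr (LinearMap.surjective_of_ne_zero hφ), finrank_top,
    Module.finrank_self, Module.finrank_fin_fun] at h1
  rw [IsPlane]
  omega

lemma linMap_ne_zero {n : ℕ} {a : Fin n → K} (ha : a ≠ 0) : linMap a ≠ 0 := by
  intro h
  apply ha
  ext i
  have := LinearMap.congr_fun h (Pi.single i 1)
  simpa [linMap_apply] using this

lemma linForm_dvd_of_span_eq_ker {k n : ℕ} {a : Fin n → K} (ha : a ≠ 0)
    {B : Fin k → Fin n → K}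
    (hB : Submodule.span K (Set.range B) = LinearMap.ker (linMap a)) {G : MvPolynomial (Fin n) K}
    (hG : pullback (Matrix.of B) G = 0) : linForm a ∣ G := by
  obtain ⟨i, hi⟩ := Function.ne_iff.mp ha
  refine linForm_dvd_of_pullback_eq_zero a (Pi.single i (a i)⁻¹) ?_ (Matrix.of B) (fun x hx => ?_) hG
  · simpa using mul_inv_cancel₀ hi
  · rw [← mem_span_range_iff_vecMul, hB, LinearMap.mem_ker, linMap_apply, hx]

lemma isPlane_span {B : Fin 3 → Fin 4 → K} (hB : LinearIndependent K B) :
    IsPlane (Submodule.span K (Set.range B)) := by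
  rw [IsPlane, finrank_span_eq_card hB, Fintype.card_fin]

lemma pullback_ne_zero_of_linearIndependent {F : MvPolynomial (Fin 4) K}
    (hnoplane : ¬ ∃ a : Fin 4 → K, a ≠ 0 ∧ linForm a ∣ F) {B : Fin 3 → Fin 4 → K}
    (hB : LinearIndependent K B) : pullback (Matrix.of B) F ≠ 0 := by
  intro h
  obtain ⟨a, ha, haB⟩ := exists_eq_ker_linMap (isPlane_span hB)
  exact hnoplane ⟨a, ha, linForm_dvd_of_span_eq_ker ha haB h⟩

/-- `F` vanishes, as a polynomial, on every line contained in `W`. -/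
def VanishesOn (F : MvPolynomial (Fin 4) K) (W : Submodule K (Fin 4 → K)) : Prop :=
  ∀ V ∈ W, ∀ U ∈ W, pullback (Matrix.of ![V, U]) F = 0

lemma vecMul_two {n : ℕ} (y : Fin 2 → K) (V U : Fin n → K) :
    Matrix.vecMul y (Matrix.of ![V, U]) = y 0 • V + y 1 • U := by
  simp [Matrix.vecMul_eq_sum, Fin.sum_univ_two]
  rfl

lemma vecMul_three {n : ℕ} (y : Fin 3 → K) (V U Q : Fin n → K) :
    Matrix.vecMul y (Matrix.of ![V, U, Q]) = y 0 • V + y 1 • U + y 2 • Q := by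
  simp [Matrix.vecMul_eq_sum, Fin.sum_univ_three]
  rfl

lemma pullback_eq_zero_of_mem_span {k l n : ℕ} {F : MvPolynomial (Fin n) K}
    {B : Fin k → Fin n → K} (hB : pullback (Matrix.of B) F = 0) (A : Fin l → Fin n → K)
    (hA : ∀ i, A i ∈ Submodule.span K (Set.range B)) : pullback (Matrix.of A) F = 0 := by
  simp only [mem_span_range_iff_vecMul] at hA
  choose M hM using hA
  have : Matrix.of A = Matrix.of M * Matrix.of B := by
    ext i j
    rw [Matrix.of_apply, ← hM i]
    rfl
  rw [this, ← pullback_pullback, hB]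
  simp [pullback]

lemma vanishesOn_span {F : MvPolynomial (Fin 4) K} {V U : Fin 4 → K}
    (h : pullback (Matrix.of ![V, U]) F = 0) : VanishesOn F (Submodule.span K {V, U}) := by
  intro V' hV' U' hU'
  refine pullback_eq_zero_of_mem_span h _ fun i => ?_
  rw [range_pair]
  fin_cases i
  · exact hV'
  · exact hU'

lemma VanishesOn.eval_eq_zero {F : MvPolynomial (Fin 4) K} {W : Submodule K (Fin 4 → K)}
    (h : VanishesOn F W) {v : Fin 4 → K} (hv : v ∈ W) : eval v F = 0 := by
  have := eval_eq_zero_of_pullback (h v hv v hv) ![1, 0]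
  simpa [vecMul_two] using this

lemma VanishesOn.alongLine_eq_zero {F : MvPolynomial (Fin 4) K} {W : Submodule K (Fin 4 → K)}
    (h : VanishesOn F W) {P v : Fin 4 → K} (hP : P ∈ W) (hv : v ∈ W) : alongLine F P v = 0 := by
  have h1 := alongLine_pullback (Matrix.of ![P, v]) F ![1, 0] ![0, 1]
  rw [h P hP v hv, vecMul_two, vecMul_two] at h1
  simpa [alongLine] using h1.symm

lemma VanishesOn.differential_eq_zero {F : MvPolynomial (Fin 4) K}
    {W : Submodule K (Fin 4 → K)} (h : VanishesOn F W) {P v : Fin 4 → K} (hP : P ∈ W)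
    (hv : v ∈ W) : differential F P v = 0 := by
  rw [differential_eq_eval_derivative, h.alongLine_eq_zero hP hv]
  simp

lemma linearIndependent_three {n : ℕ} {V U w : Fin n → K} {ℓ : Submodule K (Fin n → K)}
    (hV : V ∈ ℓ) (hU : U ∈ ℓ) (hVU : LinearIndependent K ![V, U]) (hw : w ∉ ℓ) :
    LinearIndependent K ![V, U, w] := by
  rw [LinearIndependent.pair_iff] at hVU
  rw [Fintype.linearIndependent_iff]
  intro g hg
  simp only [Fin.sum_univ_three, Matrix.cons_val_zero, Matrix.cons_val_one, Matrix.cons_val] at hg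
  have h2 : g 2 = 0 := by
    by_contra h2
    apply hw
    have : w = (g 2)⁻¹ • (-(g 0 • V) - g 1 • U) := by
      rw [eq_inv_smul_iff₀ h2, ← sub_eq_zero, ← hg]; abel
    rw [this]
    exact ℓ.smul_mem _ (ℓ.sub_mem (ℓ.neg_mem (ℓ.smul_mem _ hV)) (ℓ.smul_mem _ hU))
  rw [h2, zero_smul, add_zero] at hg
  obtain ⟨h0, h1⟩ := hVU _ _ hg
  intro i; fin_cases i <;> assumption

lemma span_pair_eq {n : ℕ} {V U : Fin n → K} {ℓ : Submodule K (Fin n → K)} (hℓ : IsLine ℓ)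
    (hV : V ∈ ℓ) (hU : U ∈ ℓ) (hVU : LinearIndependent K ![V, U]) :
    Submodule.span K {V, U} = ℓ := by
  apply Submodule.eq_of_le_of_finrank_eq
  · rw [Submodule.span_le]
    rintro x (rfl | rfl) <;> assumption
  · rw [hℓ, ← range_pair, finrank_span_eq_card hVU, Fintype.card_fin]

lemma exists_eq_of_mem_line {n : ℕ} {V U : Fin n → K} {ℓ : Submodule K (Fin n → K)} (hℓ : IsLine ℓ)
    (hV : V ∈ ℓ) (hU : U ∈ ℓ) (hVU : LinearIndependent K ![V, U]) {x : Fin n → K} (hx : x ∈ ℓ) :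
    ∃ a b : K, x = a • V + b • U := by
  rw [← span_pair_eq hℓ hV hU hVU, Submodule.mem_span_pair] at hx
  obtain ⟨a, b, h⟩ := hx
  exact ⟨a, b, h.symm⟩

lemma isLine_span_pair {n : ℕ} {V U : Fin n → K} (hVU : LinearIndependent K ![V, U]) :
    IsLine (Submodule.span K {V, U}) := by
  rw [IsLine, ← range_pair, finrank_span_eq_card hVU, Fintype.card_fin]

lemma exists_linearIndependent_pair {n : ℕ} {V : Fin n → K} {ℓ : Submodule K (Fin n → K)}
    (hℓ : IsLine ℓ) (hV0 : V ≠ 0) :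
    ∃ U ∈ ℓ, LinearIndependent K ![V, U] := by
  by_contra! h
  have hle : ℓ ≤ Submodule.span K {V} := by
    intro U hU
    have h1 := h U hU
    rw [LinearIndependent.pair_iff' hV0] at h1
    push Not at h1
    obtain ⟨a, ha⟩ := h1
    exact Submodule.mem_span_singleton.mpr ⟨a, ha⟩
  have h1 := Submodule.finrank_mono hle
  rw [finrank_span_singleton hV0, hℓ] at h1
  omega

lemma exists_linearIndependent_pair_of_isLine {n : ℕ} {ℓ : Submodule K (Fin n → K)}
    (hℓ : IsLine ℓ) : ∃ V ∈ ℓ, ∃ U ∈ ℓ, LinearIndependent K ![V, U] := by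
  have : ℓ ≠ ⊥ := by
    rintro rfl
    rw [IsLine, finrank_bot] at hℓ
    omega
  obtain ⟨V, hV, hV0⟩ := Submodule.exists_mem_ne_zero_of_ne_bot this
  obtain ⟨U, hU, h⟩ := exists_linearIndependent_pair hℓ hV0
  exact ⟨V, hV, U, hU, h⟩

lemma span_three_eq {V U Q : Fin 4 → K} {W : Submodule K (Fin 4 → K)} (hW : IsPlane W)
    (hV : V ∈ W) (hU : U ∈ W) (hQ : Q ∈ W) (hB : LinearIndependent K ![V, U, Q]) :
    Submodule.span K (Set.range ![V, U, Q]) = W := by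
  apply Submodule.eq_of_le_of_finrank_eq
  · rw [Submodule.span_le]
    rintro _ ⟨i, rfl⟩
    fin_cases i <;> assumption
  · rw [hW, isPlane_span hB]

end Planes

section Surface

/-- In the coordinates given by `V, U, Q`, the restriction of `F` is a product of the linear form
`z` and `e` distinct linear forms `y - γ z`. -/
def IsPencilFrame (F : MvPolynomial (Fin 4) K) (e : ℕ) (V U Q : Fin 4 → K) : Prop :=
  ∃ c : K, c ≠ 0 ∧ ∃ Γ : Finset K, Γ.card = e ∧
    pullback (Matrix.of ![V, U, Q]) F =
      C c * (linForm ![0, 0, 1] * ∏ γ ∈ Γ, linForm ![0, 1, -γ])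

lemma linForm_dvd_pullback {F : MvPolynomial (Fin 4) K} {ℓ : Submodule K (Fin 4 → K)}
    (hF : VanishesOn F ℓ) {V U : Fin 4 → K} (hV : V ∈ ℓ) (hU : U ∈ ℓ) (w : Fin 4 → K) :
    linForm ![0, 0, 1] ∣ pullback (Matrix.of ![V, U, w]) F := by
  apply X_two_dvd_of_pullback
  rw [pullback_pullback]
  convert hF V hV U hU using 2
  ext i j
  fin_cases i <;> simp [Matrix.mul_apply, Fin.sum_univ_three]

variable [Fintype K]

lemma card_line {ℓ : Submodule K (Fin 4 → K)} [Fintype ℓ] (hℓ : IsLine ℓ) :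
    Fintype.card ℓ = Fintype.card K ^ 2 := by
  rw [Module.card_eq_pow_finrank (K := K), hℓ]

variable [DecidableEq K]

lemma card_affine_zeros {F : MvPolynomial (Fin 4) K} {ℓ : Submodule K (Fin 4 → K)} [Fintype ℓ]
    (hℓ : IsLine ℓ) {V U w : Fin 4 → K} (hV : V ∈ ℓ) (hU : U ∈ ℓ)
    (hVU : LinearIndependent K ![V, U]) :
    (Finset.univ.filter fun p : K × K =>
      eval ![p.1, p.2, 1] (pullback (Matrix.of ![V, U, w]) F) = 0).card =
    (Finset.univ.filter fun v : ℓ => eval (w + v.1) F = 0).card := by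
  have hev : ∀ p : K × K, eval ![p.1, p.2, 1] (pullback (Matrix.of ![V, U, w]) F) =
      eval (w + (p.1 • V + p.2 • U)) F := by
    intro p
    rw [eval_pullback, vecMul_three]
    simp [add_comm]
  simp only [hev]
  refine Finset.card_bij
    (fun p _ => ⟨p.1 • V + p.2 • U, ℓ.add_mem (ℓ.smul_mem _ hV) (ℓ.smul_mem _ hU)⟩) ?_ ?_ ?_
  · intro p hp; simpa using hp
  · intro p _ p' _ h
    simp only [Subtype.mk.injEq] at h
    obtain ⟨h1, h2⟩ := hVU.eq_of_pair h
    exact Prod.ext h1 h2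
  · rintro ⟨v, hv⟩ hm
    obtain ⟨a, b, rfl⟩ := exists_eq_of_mem_line hℓ hV hU hVU hv
    exact ⟨(a, b), by simpa using hm, rfl⟩

variable {e : ℕ} {F : MvPolynomial (Fin 4) K}

lemma card_coset_le (hhom : F.IsHomogeneous (e + 1))
    (hnoplane : ¬ ∃ a : Fin 4 → K, a ≠ 0 ∧ linForm a ∣ F)
    {ℓ : Submodule K (Fin 4 → K)} [Fintype ℓ] (hℓ : IsLine ℓ) (hF : VanishesOn F ℓ)
    {w : Fin 4 → K} (hw : w ∉ ℓ) :
    (Finset.univ.filter fun v : ℓ => eval (w + v.1) F = 0).card ≤ e * Fintype.card K := by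
  classical
  obtain ⟨V, hV, U, hU, hVU⟩ := exists_linearIndependent_pair_of_isLine hℓ
  obtain ⟨h, -, -, hle⟩ := affine_zeros_bound (pullback_isHomogeneous _ hhom)
    (pullback_ne_zero_of_linearIndependent hnoplane (linearIndependent_three hV hU hVU hw))
    (linForm_dvd_pullback hF hV hU w)
    (Finset.univ.filter fun γ => alongLine (pullback (Matrix.of ![V, U, w]) F)
      ![0, γ, 1] ![1, 0, 0] = 0) (by simp)
  rw [card_affine_zeros hℓ hV hU hVU] at hle
  omega

/-- The number of vectors on the cone over a surface of degree `e + 1` attaining the elementary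
bound. -/
def IsExtremal (F : MvPolynomial (Fin 4) K) (e : ℕ) : Prop :=
  (Finset.univ.filter fun v : Fin 4 → K => eval v F = 0).card =
    Fintype.card K ^ 2 + (Fintype.card K ^ 2 - 1) * (e * Fintype.card K)

lemma card_coset_eq (hhom : F.IsHomogeneous (e + 1))
    (hnoplane : ¬ ∃ a : Fin 4 → K, a ≠ 0 ∧ linForm a ∣ F) (hZ : IsExtremal F e)
    {ℓ : Submodule K (Fin 4 → K)} [Fintype ℓ] (hℓ : IsLine ℓ) (hF : VanishesOn F ℓ)
    {w : Fin 4 → K} (hw : w ∉ ℓ) :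
    (Finset.univ.filter fun v : ℓ => eval (w + v.1) F = 0).card = e * Fintype.card K := by
  classical
  have h1 : ∑ w : Fin 4 → K, (Finset.univ.filter fun v : ℓ => eval (w + v.1) F = 0).card =
      Fintype.card ℓ * (Finset.univ.filter fun v : Fin 4 → K => eval v F = 0).card :=
    card_filter_perm (A := ℓ) (Finset.univ : Finset (Fin 4 → K))
      (fun v => Equiv.addRight (v : Fin 4 → K)) (fun v => eval v F = 0) (by simp)
  rw [hZ, card_line hℓ, ← Finset.sum_filter_add_sum_filter_not _ (· ∈ ℓ)] at h1
  have hc1 : (Finset.univ.filter fun v : Fin 4 → K => v ∈ ℓ).card = Fintype.card K ^ 2 := by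
    rw [← card_line hℓ, Fintype.card_subtype]
  have h2 : ∑ w ∈ Finset.univ.filter (· ∈ ℓ),
      (Finset.univ.filter fun v : ℓ => eval (w + v.1) F = 0).card =
        Fintype.card K ^ 2 * Fintype.card K ^ 2 := by
    rw [Finset.sum_congr rfl (g := fun _ => Fintype.card K ^ 2), Finset.sum_const, hc1, smul_eq_mul]
    intro w hw
    rw [Finset.filter_true_of_mem, Finset.card_univ, card_line hℓ]
    intro v _
    exact hF.eval_eq_zero (ℓ.add_mem (by simpa using hw) v.2)
  have hc2 : (Finset.univ.filter fun v : Fin 4 → K => v ∉ ℓ).card =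
      Fintype.card K ^ 2 * (Fintype.card K ^ 2 - 1) := by
    have := Finset.card_filter_add_card_filter_not (s := (Finset.univ : Finset (Fin 4 → K)))
      (fun v => v ∈ ℓ)
    rw [hc1, Finset.card_univ, Fintype.card_fun, Fintype.card_fin] at this
    rw [Nat.mul_sub, mul_one, ← pow_add]
    exact Nat.eq_sub_of_add_eq' this
  rw [h2, mul_add, Nat.add_left_cancel_iff, ← mul_assoc, ← hc2, ← smul_eq_mul (Finset.card _),
    ← Finset.sum_const] at h1
  exact (Finset.sum_eq_sum_iff_of_le fun w hw => card_coset_le hhom hnoplane hℓ hF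
    (by simpa using hw)).mp h1 w (by simpa using hw)

/-- Every plane through a line of an extremal surface cuts out a pencil. -/
lemma exists_isPencilFrame (he1 : 1 ≤ e) (he : e ≤ Fintype.card K) (hhom : F.IsHomogeneous (e + 1))
    (hnoplane : ¬ ∃ a : Fin 4 → K, a ≠ 0 ∧ linForm a ∣ F) (hZ : IsExtremal F e)
    {ℓ : Submodule K (Fin 4 → K)} (hℓ : IsLine ℓ) (hF : VanishesOn F ℓ)
    {w : Fin 4 → K} (hw : w ∉ ℓ) :
    ∃ V ∈ ℓ, ∃ U ∈ ℓ, ∃ Q, Q - w ∈ ℓ ∧ LinearIndependent K ![V, U] ∧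
      IsPencilFrame F e V U Q := by
  classical
  have : Fintype ℓ := Fintype.ofFinite ℓ
  obtain ⟨V₀, hV₀, U₀, hU₀, hVU₀⟩ := exists_linearIndependent_pair_of_isLine hℓ
  obtain ⟨p, v, hv, hline⟩ := exists_affine_line he1 he (pullback_isHomogeneous _ hhom)
    (pullback_ne_zero_of_linearIndependent hnoplane (linearIndependent_three hV₀ hU₀ hVU₀ hw))
    (linForm_dvd_pullback hF hV₀ hU₀ w)
    (by rw [card_affine_zeros hℓ hV₀ hU₀ hVU₀, card_coset_eq hhom hnoplane hZ hℓ hF hw])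
  rw [alongLine_pullback, vecMul_three, vecMul_three] at hline
  simp only [Matrix.cons_val_zero, Matrix.cons_val_one, Matrix.cons_val, one_smul, zero_smul,
    add_zero] at hline
  set V := v.1 • V₀ + v.2 • U₀ with hVdef
  set Q := p.1 • V₀ + p.2 • U₀ + w with hQdef
  have hV : V ∈ ℓ := ℓ.add_mem (ℓ.smul_mem _ hV₀) (ℓ.smul_mem _ hU₀)
  have hQw : Q - w ∈ ℓ := by
    rw [hQdef, add_sub_cancel_right]
    exact ℓ.add_mem (ℓ.smul_mem _ hV₀) (ℓ.smul_mem _ hU₀)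
  have hQ : Q ∉ ℓ := fun h => hw (by simpa using ℓ.sub_mem h hQw)
  have hVne : V ≠ 0 := by
    intro h0
    rw [LinearIndependent.pair_iff] at hVU₀
    obtain ⟨h1, h2⟩ := hVU₀ _ _ (hVdef ▸ h0)
    exact hv (Prod.ext h1 h2)
  obtain ⟨U, hU, hVU⟩ := exists_linearIndependent_pair hℓ hVne
  refine ⟨V, hV, U, hU, Q, hQw, hVU, ?_⟩
  set f := pullback (Matrix.of ![V, U, Q]) F with hf
  have hf0 : f ≠ 0 := pullback_ne_zero_of_linearIndependent hnoplane
    (linearIndependent_three hV hU hVU hQ)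
  set Γ := Finset.univ.filter fun γ => alongLine f ![0, γ, 1] ![1, 0, 0] = 0 with hΓ
  obtain ⟨h, hfh, hdeg, hle⟩ := affine_zeros_bound (pullback_isHomogeneous _ hhom) hf0
    (linForm_dvd_pullback hF hV hU Q) Γ
    (fun γ => by simp only [hΓ, Finset.mem_filter, Finset.mem_univ, true_and, hf])
  rw [card_affine_zeros hℓ hV hU hVU, card_coset_eq hhom hnoplane hZ hℓ hF hQ] at hle
  have h0 : 0 < Γ.card := by
    rw [Finset.card_pos]
    refine ⟨0, ?_⟩
    simp only [hΓ, Finset.mem_filter, Finset.mem_univ, true_and]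
    rw [hf, alongLine_pullback, vecMul_three, vecMul_three]
    simpa using hline
  have hk : Γ.card = e := by
    have : Γ.card * (e - Γ.card) = 0 := by omega
    rcases Nat.mul_eq_zero.mp this with h | h <;> omega
  have hd : h.totalDegree = 0 := by omega
  rw [totalDegree_eq_zero_iff_eq_C] at hd
  refine ⟨coeff 0 h, ?_, Γ, hk, ?_⟩
  · intro hc
    rw [hd, hc] at hfh
    apply hf0
    rw [hf, hfh]; simp
  · conv_lhs => rw [hfh, hd]
    ring

end Surface

section Pencil

lemma pullback_add {k n : ℕ} (B : Matrix (Fin k) (Fin n) K) (F G : MvPolynomial (Fin n) K) :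
    pullback B (F + G) = pullback B F + pullback B G := map_add _ _ _

lemma pullback_sub {k n : ℕ} (B : Matrix (Fin k) (Fin n) K) (F G : MvPolynomial (Fin n) K) :
    pullback B (F - G) = pullback B F - pullback B G := map_sub _ _ _

lemma differential_pullback {k n : ℕ} (B : Matrix (Fin k) (Fin n) K) (F : MvPolynomial (Fin n) K)
    (P v : Fin k → K) : differential (pullback B F) P v =
      differential F (Matrix.vecMul P B) (Matrix.vecMul v B) := by
  rw [differential_eq_eval_derivative, differential_eq_eval_derivative, alongLine_pullback]

lemma exists_mem_notMem {n : ℕ} {W W' : Submodule K (Fin n → K)}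
    (h : Module.finrank K W < Module.finrank K W') : ∃ w ∈ W', w ∉ W := by
  by_contra! hle
  exact absurd (Submodule.finrank_mono (show W' ≤ W from hle)) (by omega)

lemma exists_mem_ker_notMem (φ : (Fin 4 → K) →ₗ[K] K) {ℓ : Submodule K (Fin 4 → K)}
    (hℓ : IsLine ℓ) : ∃ w, φ w = 0 ∧ w ∉ ℓ := by
  obtain ⟨w, hw, hwℓ⟩ := exists_mem_notMem (W := ℓ) (W' := LinearMap.ker φ) (by
    have h1 := LinearMap.finrank_range_add_finrank_ker φ
    have h2 := Submodule.finrank_le (LinearMap.range φ)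
    rw [Module.finrank_self] at h2
    rw [Module.finrank_fin_fun] at h1
    rw [hℓ]
    omega)
  exact ⟨w, hw, hwℓ⟩

lemma isLine_inf_ker {H : Submodule K (Fin 4 → K)} (hH : IsPlane H) {φ : (Fin 4 → K) →ₗ[K] K}
    {w : Fin 4 → K} (hw : w ∈ H) (hφ : φ w ≠ 0) : IsLine (H ⊓ LinearMap.ker φ) := by
  have h0 : φ.domRestrict H ≠ 0 := fun h => hφ (by simpa using LinearMap.congr_fun h ⟨w, hw⟩)
  have h1 := LinearMap.finrank_range_add_finrank_ker (φ.domRestrict H)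
  rw [LinearMap.range_eq_top.mpr (LinearMap.surjective_of_ne_zero h0), finrank_top,
    Module.finrank_self, hH, LinearMap.ker_domRestrict] at h1
  have h2 := LinearEquiv.finrank_eq (Submodule.comapSubtypeEquivOfLe
    (inf_le_left : H ⊓ LinearMap.ker φ ≤ H))
  rw [Submodule.comap_inf, Submodule.comap_subtype_self, top_inf_eq] at h2
  rw [IsLine, ← h2]
  change 1 + Module.finrank K (Submodule.comap H.subtype (LinearMap.ker φ)) = 3 at h1
  omega

lemma exists_dual {k n : ℕ} {B : Fin k → Fin n → K} (hB : LinearIndependent K B) :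
    ∃ β : Fin k → Fin n → K, ∀ i j, linMap (β j) (B i) = (Pi.single i 1 : Fin k → K) j := by
  have hinj : LinearMap.ker (Matrix.vecMulLinear (Matrix.of B)) = ⊥ := by
    rw [LinearMap.ker_eq_bot]
    exact Matrix.vecMul_injective_iff.mpr hB
  obtain ⟨g, hg⟩ := LinearMap.exists_leftInverse_of_injective _ hinj
  have hβ : ∀ j v, linMap (fun i => g (Pi.single i 1) j) v = g v j := by
    intro j v
    have h1 : linMap (fun i => g (Pi.single i 1) j) = LinearMap.proj j ∘ₗ g := by
      ext i
      simp [linMap_apply]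
    rw [h1]
    rfl
  refine ⟨fun j i => g (Pi.single i 1) j, fun i j => ?_⟩
  have h1 := LinearMap.congr_fun hg (Pi.single i 1)
  rw [LinearMap.comp_apply, Matrix.vecMulLinear_apply, Matrix.single_one_vecMul] at h1
  rw [hβ, ← LinearMap.id_apply (R := K) (Pi.single i 1 : Fin k → K), ← h1]
  rfl

lemma pullback_linForm_of {k n : ℕ} (B : Fin k → Fin n → K) (b : Fin n → K) :
    pullback (Matrix.of B) (linForm b) = linForm fun i => linMap b (B i) := by
  rw [pullback_linForm]
  congr 1
  ext i
  rw [linMap_apply, dotProduct_comm]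
  rfl

lemma pullback_linForm_eq_zero {n : ℕ} {b V U : Fin n → K} (hV : linMap b V = 0)
    (hU : linMap b U = 0) : pullback (Matrix.of ![V, U]) (linForm b) = 0 := by
  rw [pullback_linForm_of]
  simp [linForm, Fin.sum_univ_two, hV, hU]

section Frame

variable {F : MvPolynomial (Fin 4) K} {V U Q : Fin 4 → K} {c : K} {Γ : Finset K}

lemma eval_of_frame (h : pullback (Matrix.of ![V, U, Q]) F =
      C c * (linForm ![0, 0, 1] * ∏ γ ∈ Γ, linForm ![0, 1, -γ])) (x y z : K) :
    eval (x • V + y • U + z • Q) F = c * (z * ∏ γ ∈ Γ, (y - γ * z)) := by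
  have h1 := congrArg (eval ![x, y, z]) h
  rw [eval_pullback, vecMul_three] at h1
  simpa [eval_linForm, map_prod, dotProduct, Fin.sum_univ_three, ← sub_eq_add_neg] using h1

lemma differential_of_frame (h : pullback (Matrix.of ![V, U, Q]) F =
      C c * (linForm ![0, 0, 1] * ∏ γ ∈ Γ, linForm ![0, 1, -γ])) (x y : K) :
    differential F (x • V + y • U) Q = c * y ^ Γ.card := by
  have h1 := differential_pullback (Matrix.of ![V, U, Q]) F ![x, y, 0] ![0, 0, 1]
  rw [vecMul_three, vecMul_three, h, differential_mul, differential_mul, differential_C,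
    differential_linForm] at h1
  simp [eval_linForm, map_prod, dotProduct, Fin.sum_univ_three] at h1
  exact h1.symm

lemma card_roots_of_frame [Fintype K] [DecidableEq K] (hc : c ≠ 0)
    (h : pullback (Matrix.of ![V, U, Q]) F =
      C c * (linForm ![0, 0, 1] * ∏ γ ∈ Γ, linForm ![0, 1, -γ])) {p₀ p₁ x y z : K} (hp : p₁ ≠ 0)
    (hz : z ≠ 0) :
    (Finset.univ.filter fun t : K =>
      eval (x • V + y • U + z • Q + t • (p₀ • V + p₁ • U)) F = 0).card = Γ.card := by
  refine (Finset.card_bij (fun γ _ => (γ * z - y) / p₁) ?_ ?_ ?_).symm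
  · intro γ hγ
    have h1 : x • V + y • U + z • Q + ((γ * z - y) / p₁) • (p₀ • V + p₁ • U) =
        (x + (γ * z - y) / p₁ * p₀) • V + (γ * z) • U + z • Q := by
      have : (γ * z) • U = y • U + ((γ * z - y) / p₁ * p₁) • U := by
        rw [div_mul_cancel₀ _ hp, ← add_smul, add_sub_cancel]
      rw [this]
      module
    simp only [Finset.mem_filter, Finset.mem_univ, true_and]
    rw [h1, eval_of_frame h, Finset.prod_eq_zero hγ (sub_self (γ * z)), mul_zero, mul_zero]
  · intro γ _ γ' _ heq
    rw [div_left_inj' hp, sub_left_inj] at heq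
    exact mul_right_cancel₀ hz heq
  · intro t ht
    have h1 : x • V + y • U + z • Q + t • (p₀ • V + p₁ • U) =
        (x + t * p₀) • V + (y + t * p₁) • U + z • Q := by module
    simp only [Finset.mem_filter, Finset.mem_univ, true_and] at ht
    rw [h1, eval_of_frame h] at ht
    have h2 : ∏ γ ∈ Γ, (y + t * p₁ - γ * z) = 0 := by
      rcases mul_eq_zero.mp ht with h | h
      · exact absurd h hc
      · exact (mul_eq_zero.mp h).resolve_left hz
    obtain ⟨γ, hγ, h3⟩ := Finset.prod_eq_zero_iff.mp h2
    refine ⟨γ, hγ, ?_⟩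
    rw [← sub_eq_zero.mp h3]
    field_simp
    ring

end Frame

variable {F : MvPolynomial (Fin 4) K} {e : ℕ}

lemma isPencil_of_isPencilFrame {H : Submodule K (Fin 4 → K)} (hH : IsPlane H) {V U Q : Fin 4 → K}
    (hV : V ∈ H) (hU : U ∈ H) (hQ : Q ∈ H) (hB : LinearIndependent K ![V, U, Q])
    (hframe : IsPencilFrame F e V U Q) {P : Projectivization K (Fin 4 → K)} {t : K}
    (hP : P.rep = t • V) : IsPencil F (e + 1) H P := by
  obtain ⟨c, hc, Γ, hΓ, hpull⟩ := hframe
  obtain ⟨a, ha, haH⟩ := exists_eq_ker_linMap hH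
  obtain ⟨β, hβ⟩ := exists_dual hB
  set γ : Fin e → K := fun i => (Γ.equivFinOfCardEq hΓ).symm i with hγ
  set m : Fin (e + 1) → Fin 4 → K := Fin.cons (β 2) fun i => β 1 - γ i • β 2 with hm
  have hlin : ∀ (b b' : Fin 4 → K) (s : K) (v), linMap (b - s • b') v =
      linMap b v - s * linMap b' v := by
    intro b b' s v
    simp [linMap_apply, sub_dotProduct]
  have hm0 : ∀ v, linMap (m 0) v = linMap (β 2) v := fun v => rfl
  have hms : ∀ i v, linMap (m (Fin.succ i)) v = linMap (β 1) v - γ i * linMap (β 2) v :=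
    fun i v => hlin _ _ _ _
  have hV1 : linMap (β 1) V = 0 := by simpa using hβ 0 1
  have hV2 : linMap (β 2) V = 0 := by simpa using hβ 0 2
  have hU1 : linMap (β 1) U = 1 := by simpa using hβ 1 1
  have hU2 : linMap (β 2) U = 0 := by simpa using hβ 1 2
  have hQ1 : linMap (β 1) Q = 0 := by simpa using hβ 2 1
  have hQ2 : linMap (β 2) Q = 1 := by simpa using hβ 2 2
  have hγinj : Function.Injective γ := fun i j h =>
    (Γ.equivFinOfCardEq hΓ).symm.injective (Subtype.ext h)
  obtain ⟨g, hg⟩ : linForm a ∣ F - C c * ∏ i, linForm (m i) := by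
    refine linForm_dvd_of_span_eq_ker ha ((span_three_eq hH hV hU hQ hB).trans haH) ?_
    have h1 : pullback (Matrix.of ![V, U, Q]) (linForm (m 0)) = linForm ![0, 0, 1] := by
      rw [pullback_linForm_of]
      congr 1
      ext i; fin_cases i <;> simp [hm0, hV2, hU2, hQ2]
    have h2 : ∀ i : Fin e, pullback (Matrix.of ![V, U, Q]) (linForm (m i.succ)) =
        linForm ![0, 1, -γ i] := by
      intro i
      rw [pullback_linForm_of]
      congr 1
      ext j; fin_cases j <;> simp [hms, hV1, hV2, hU1, hU2, hQ1, hQ2]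
    have h3 : pullback (Matrix.of ![V, U, Q]) (∏ i, linForm (m i)) =
        linForm ![0, 0, 1] * ∏ γ ∈ Γ, linForm ![0, 1, -γ] := by
      rw [pullback, map_prod, Fin.prod_univ_succ]
      congr 1
      rw [← Finset.prod_coe_sort Γ, ← Equiv.prod_comp (Γ.equivFinOfCardEq hΓ).symm]
      exact Finset.prod_congr rfl fun i _ => h2 i
    rw [pullback_sub, pullback_mul, pullback_C, h3, hpull, sub_self]
  refine ⟨a, m, c, g, ha, haH, hc, ?_, ?_, ?_, ?_, ?_⟩
  · rw [← hg]; ring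
  · rw [← haH]
    intro i
    refine Fin.cases ?_ (fun i => ?_) i
    · exact isLine_inf_ker hH hQ (by rw [hm0, hQ2]; exact one_ne_zero)
    · exact isLine_inf_ker hH hU (by rw [hms, hU1, hU2]; simp)
  · rw [← haH]
    intro i j hij heq
    have hne : ∀ i j, i ≠ j → ∃ x ∈ H, (linMap (m i) x = 0 ↔ ¬ linMap (m j) x = 0) := by
      intro i j
      refine Fin.cases ?_ (fun i => ?_) i <;> refine Fin.cases ?_ (fun j => ?_) j <;> intro hij
      · exact absurd rfl hij
      · exact ⟨U, hU, by simp [hm0, hms, hU1, hU2]⟩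
      · exact ⟨U, hU, by simp [hm0, hms, hU1, hU2]⟩
      · refine ⟨γ i • U + Q, H.add_mem (H.smul_mem _ hU) hQ, ?_⟩
        simp only [hms, map_add, map_smul, hU1, hU2, hQ1, hQ2, smul_eq_mul]
        have : γ i ≠ γ j := fun h => hij (congrArg Fin.succ (hγinj h))
        simp [sub_eq_zero, this]
    obtain ⟨x, hx, h⟩ := hne i j hij
    have h1 : linMap (m i) x = 0 ↔ linMap (m j) x = 0 := by
      have := SetLike.ext_iff.mp heq x
      simpa [hx] using this
    tauto
  · rw [hP]; exact H.smul_mem _ hV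
  · intro i
    rw [hP, map_smul]
    refine Fin.cases ?_ (fun i => ?_) i
    · rw [hm0, hV2, smul_zero]
    · rw [hms, hV1, hV2]; simp

variable {H : Submodule K (Fin 4 → K)} {P : Projectivization K (Fin 4 → K)}

lemma IsPencil.rep_mem (h : IsPencil F e H P) : P.rep ∈ H := by
  obtain ⟨a, m, c, g, -, -, -, -, -, -, hP, -⟩ := h
  exact hP

lemma IsPencil.eval_rep (h : IsPencil F (e + 1) H P) : eval P.rep F = 0 := by
  obtain ⟨a, m, c, g, -, rfl, -, hF, -, -, hP, hmP⟩ := h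
  rw [LinearMap.mem_ker, linMap_apply] at hP
  simp only [linMap_apply] at hmP
  rw [hF, Fin.prod_univ_succ]
  simp [eval_linForm, hP, hmP]

lemma IsPencil.differential_eq_zero (he : 1 ≤ e) (h : IsPencil F (e + 1) H P) {v : Fin 4 → K}
    (hv : v ∈ H) : differential F P.rep v = 0 := by
  obtain ⟨e, rfl⟩ := Nat.exists_eq_add_of_le' he
  obtain ⟨a, m, c, g, -, rfl, -, hF, -, -, hP, hmP⟩ := h
  rw [LinearMap.mem_ker, linMap_apply] at hP hv
  simp only [linMap_apply] at hmP
  rw [hF, Fin.prod_univ_succ, Fin.prod_univ_succ]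
  simp [differential_add, differential_mul, differential_C, differential_linForm, eval_linForm,
    hP, hmP, hv]

lemma IsPencil.vanishesOn (h : IsPencil F (e + 1) H P) {v : Fin 4 → K}
    (hv : v ∈ H) (hFv : eval v F = 0) : VanishesOn F (Submodule.span K {P.rep, v}) := by
  obtain ⟨a, m, c, g, -, rfl, hc, hF, -, -, hP, hmP⟩ := h
  apply vanishesOn_span
  have hav : a ⬝ᵥ v = 0 := by rwa [LinearMap.mem_ker, linMap_apply] at hv
  rw [hF] at hFv
  simp only [map_add, map_mul, eval_C, map_prod, eval_linForm, hav, zero_mul, add_zero,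
    mul_eq_zero, hc, false_or, Finset.prod_eq_zero_iff, Finset.mem_univ, true_and] at hFv
  obtain ⟨i, hi⟩ := hFv
  have h1 : pullback (Matrix.of ![P.rep, v]) (linForm (m i)) = 0 :=
    pullback_linForm_eq_zero (hmP i) (by rwa [linMap_apply])
  rw [← Finset.mul_prod_erase _ _ (Finset.mem_univ i)] at hF
  have h2 : pullback (Matrix.of ![P.rep, v]) (linForm a) = 0 := pullback_linForm_eq_zero hP hv
  rw [hF, pullback_add, pullback_mul, pullback_mul, pullback_mul, h1, h2, zero_mul, zero_mul, mul_zero,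
    add_zero]

lemma SectionHasLineComp.exists_isLine (h : SectionHasLineComp F H) :
    ∃ ℓ ≤ H, IsLine ℓ ∧ VanishesOn F ℓ := by
  obtain ⟨a, b, f, g, -, rfl, hℓ, hF⟩ := h
  refine ⟨_, inf_le_left, hℓ, fun V hV U hU => ?_⟩
  have h1 : pullback (Matrix.of ![V, U]) (linForm a) = 0 := pullback_linForm_eq_zero hV.1 hU.1
  have h2 : pullback (Matrix.of ![V, U]) (linForm b) = 0 := pullback_linForm_eq_zero hV.2 hU.2
  rw [hF, pullback_add, pullback_mul, pullback_mul, h1, h2, zero_mul, zero_mul, add_zero]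

end Pencil

section Tangent

lemma card_filter_eq_projectivization [Fintype K] {n : ℕ} (R : (Fin n → K) → Prop)
    [DecidablePred R] (h0 : R 0) (hR : ∀ (u : Kˣ) v, R (u • v) ↔ R v) :
    (Finset.univ.filter R).card =
      (Fintype.card K - 1) * Nat.card {p : Projectivization K (Fin n → K) // R p.rep} + 1 := by
  classical
  have h1 : Nat.card ({p : Projectivization K (Fin n → K) // R p.rep} × Kˣ) =
      Nat.card {v : Fin n → K // v ≠ 0 ∧ R v} := by
    refine Nat.card_eq_of_bijective
      (fun p => ⟨p.2 • p.1.1.rep, (smul_ne_zero_iff_ne p.2).mpr p.1.1.rep_nonzero,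
        (hR _ _).mpr p.1.2⟩) ⟨?_, ?_⟩
    · rintro ⟨⟨p, hp⟩, u⟩ ⟨⟨p', hp'⟩, u'⟩ h
      simp only [Subtype.mk.injEq] at h
      have hpp : p = p' := by
        rw [← p.mk_rep, ← p'.mk_rep, Projectivization.mk_eq_mk_iff]
        exact ⟨u⁻¹ * u', by rw [mul_smul, ← h, inv_smul_smul]⟩
      subst hpp
      have : u = u' := Units.ext (smul_left_injective K p.rep_nonzero h)
      rw [this]
    · rintro ⟨v, hv, hRv⟩
      obtain ⟨a, ha⟩ := Projectivization.exists_smul_eq_mk_rep K v hv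
      refine ⟨⟨⟨Projectivization.mk K v hv, ?_⟩, a⁻¹⟩, ?_⟩
      · rw [← ha, hR]; exact hRv
      · ext1
        change a⁻¹ • (Projectivization.mk K v hv).rep = v
        rw [← ha, inv_smul_smul]
  rw [Nat.card_prod, Nat.card_eq_fintype_card (α := Kˣ), Fintype.card_units, mul_comm,
    Nat.card_eq_fintype_card (α := {v : Fin n → K // v ≠ 0 ∧ R v}), Fintype.card_subtype] at h1
  rw [h1, ← Finset.card_erase_add_one (a := 0) (by simpa using h0)]
  congr 2
  ext v
  simp

lemma IsPencilFrame.eq_smul_of_differential_eq_zero {F : MvPolynomial (Fin 4) K} {e : ℕ} (he : 1 ≤ e)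
    {V U Q : Fin 4 → K}
    {ℓ : Submodule K (Fin 4 → K)}
    (h : IsPencilFrame F e V U Q) (hℓ : IsLine ℓ) (hV : V ∈ ℓ) (hU : U ∈ ℓ)
    (hVU : LinearIndependent K ![V, U]) {P : Fin 4 → K} (hP : P ∈ ℓ)
    (hD : differential F P Q = 0) : ∃ t : K, P = t • V := by
  obtain ⟨c, hc, Γ, hΓ, h⟩ := h
  obtain ⟨x, y, rfl⟩ := exists_eq_of_mem_line hℓ hV hU hVU hP
  rw [differential_of_frame h, hΓ, mul_eq_zero, pow_eq_zero_iff (by omega)] at hD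
  exact ⟨x, by rw [hD.resolve_left hc, zero_smul, add_zero]⟩

variable [Fintype K] [DecidableEq K]

/-- A surface of degree `e + 1` without plane components attaining the elementary bound. -/
structure IsExtremalSurface (F : MvPolynomial (Fin 4) K) (e : ℕ) : Prop where
  one_le : 1 ≤ e
  le_card : e ≤ Fintype.card K
  isHomogeneous : F.IsHomogeneous (e + 1)
  not_dvd : ¬ ∃ a : Fin 4 → K, a ≠ 0 ∧ linForm a ∣ F
  isExtremal : IsExtremal F e

lemma card_filter_mem_span_singleton {n : ℕ} {P : Fin n → K} (hP : P ≠ 0) :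
    (Finset.univ.filter fun u : Fin n → K => ∃ t : K, t • P = u).card = Fintype.card K := by
  rw [← Finset.card_univ, ← Finset.card_image_of_injective _ (smul_left_injective K hP)]
  congr 1
  ext u
  simp

variable {F : MvPolynomial (Fin 4) K} {e : ℕ}

namespace IsExtremalSurface

lemma exists_isLine (hS : IsExtremalSurface F e) : ∃ ℓ, IsLine ℓ ∧ VanishesOn F ℓ := by
  have hq : 1 < Fintype.card K := Fintype.one_lt_card
  have hZ := hS.isExtremal
  rw [IsExtremal] at hZ
  set q := Fintype.card K with hqdef
  rcases hS.le_card.lt_or_eq with hlt | heq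
  · obtain ⟨P, hP, hP0⟩ : ∃ P ∈ Finset.univ.filter fun v : Fin 4 → K => eval v F = 0, P ≠ 0 := by
      apply Finset.exists_mem_ne
      rw [hZ]
      nlinarith [Nat.zero_le ((q ^ 2 - 1) * (e * q))]
    have hP1 : eval P F = 0 := by simpa using hP
    by_contra! hno
    have h1 : ∑ w : Fin 4 → K, (Finset.univ.filter fun t : K => eval (w + t • P) F = 0).card =
        q * (Finset.univ.filter fun v : Fin 4 → K => eval v F = 0).card :=
      card_filter_perm (A := K) (Finset.univ : Finset (Fin 4 → K))
        (fun t => Equiv.addRight (t • P)) (fun v => eval v F = 0) (by simp)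
    rw [← Finset.sum_filter_add_sum_filter_not _ (fun u => ∃ t : K, t • P = u)] at h1
    have hc1 := card_filter_mem_span_singleton hP0
    have hc2 := Finset.card_filter_add_card_filter_not (s := (Finset.univ : Finset (Fin 4 → K)))
      (fun u => ∃ t : K, t • P = u)
    rw [hc1, Finset.card_univ, Fintype.card_fun, Fintype.card_fin] at hc2
    have h2 := Finset.sum_le_card_nsmul (Finset.univ.filter fun u => ∃ t : K, t • P = u)
      (fun w => (Finset.univ.filter fun t : K => eval (w + t • P) F = 0).card) q
      (fun w _ => Finset.card_le_univ _)
    have h3 := Finset.sum_le_card_nsmul (Finset.univ.filter fun u => ¬ ∃ t : K, t • P = u)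
      (fun w => (Finset.univ.filter fun t : K => eval (w + t • P) F = 0).card) e (by
        intro w hw
        have hne : alongLine F w P ≠ 0 := by
          intro h0
          refine hno _ (isLine_span_pair ?_)
            (vanishesOn_span (pullback_eq_zero_of_alongLine hS.isHomogeneous h0))
          rw [LinearIndependent.pair_iff' hP0]
          simpa using hw
        refine le_trans ?_ (natDegree_alongLine_le_of_eval_eq_zero hS.isHomogeneous w P hP1)
        simpa only [eval_alongLine] using card_filter_eval_le hne)
    rw [hc1] at h2
    rw [smul_eq_mul] at h2 h3
    obtain ⟨A, hA⟩ : ∃ A, q ^ 2 = A + 1 := ⟨q ^ 2 - 1, by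
      have : 0 < q ^ 2 := by positivity
      omega⟩
    rw [hZ, hA, Nat.add_sub_cancel] at h1
    have h4 : q * (A + 1 + A * (e * q)) ≤ q * q +
        (Finset.univ.filter fun u : Fin 4 → K => ¬ ∃ t : K, t • P = u).card * e := by
      rw [← h1]; exact Nat.add_le_add h2 h3
    generalize (Finset.univ.filter fun u : Fin 4 → K => ¬ ∃ t : K, t • P = u).card = N at hc2 h4
    change q + N = q ^ 4 at hc2
    zify at h4 hc2 hA hlt hq
    have hN : (N : ℤ) = q ^ 4 - q := by linarith
    have hA' : (A : ℤ) = q ^ 2 - 1 := by linarith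
    rw [hN, hA'] at h4
    have h5 : (q : ℤ) * (q - 1) * (q - e) ≤ 0 := by nlinarith
    have : 0 < (q : ℤ) * (q - 1) * (q - e) := by
      apply mul_pos (mul_pos _ _) <;> linarith
    linarith
  · have hall : ∀ v : Fin 4 → K, eval v F = 0 := by
      have : Finset.univ.filter (fun v : Fin 4 → K => eval v F = 0) = Finset.univ := by
        rw [← Finset.card_eq_iff_eq_univ, hZ, Fintype.card_fun, Fintype.card_fin, heq, ← hqdef,
          ← pow_two, Nat.sub_mul, one_mul, ← pow_add]
        exact Nat.add_sub_cancel' (Nat.pow_le_pow_right (by omega) (by omega))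
      intro v
      have h := Finset.mem_univ v
      rw [← this] at h
      simpa using h
    obtain ⟨u, hu⟩ : ∃ u : Fin 4 → K, u ≠ 0 := exists_ne 0
    obtain ⟨P, hP, hPu⟩ := exists_mem_notMem (W := Submodule.span K {u})
      (W' := LinearMap.ker (differential F u)) (by
        have h1 := LinearMap.finrank_range_add_finrank_ker (differential F u)
        have h2 := Submodule.finrank_le (LinearMap.range (differential F u))
        rw [Module.finrank_self] at h2
        rw [Module.finrank_fin_fun] at h1
        rw [finrank_span_singleton hu]
        omega)
    have h0 : alongLine F u P = 0 := by
      refine eq_zero_of_roots_of_derivative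
        ((natDegree_alongLine_le_of_eval_eq_zero hS.isHomogeneous u P (hall P)).trans heq.le) ?_ ?_
      · intro t
        rw [eval_alongLine, hall]
      · rw [← differential_eq_eval_derivative]
        exact hP
    refine ⟨_, isLine_span_pair ?_,
      vanishesOn_span (pullback_eq_zero_of_alongLine hS.isHomogeneous h0)⟩
    rw [LinearIndependent.pair_symm_iff, LinearIndependent.pair_iff' hu]
    intro a ha
    exact hPu (Submodule.mem_span_singleton.mpr ⟨a, ha⟩)

variable {ℓ : Submodule K (Fin 4 → K)}

/-- The plane through a line of the surface and a further point `w` has a pencil frame. -/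
lemma exists_frame (hS : IsExtremalSurface F e) (hℓ : IsLine ℓ) (hF : VanishesOn F ℓ)
    {w : Fin 4 → K} (hw : w ∉ ℓ) : ∃ V ∈ ℓ, ∃ U ∈ ℓ, ∃ Q, Q - w ∈ ℓ ∧
      LinearIndependent K ![V, U] ∧ IsPencilFrame F e V U Q :=
  exists_isPencilFrame hS.one_le hS.le_card hS.isHomogeneous hS.not_dvd hS.isExtremal hℓ hF hw

/-- A plane through a line of the surface is tangent to the surface at no more than one point of
that line. -/
lemma differential_ne_zero_of_linearIndependent (hS : IsExtremalSurface F e) (hℓ : IsLine ℓ)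
    (hF : VanishesOn F ℓ) {w P R : Fin 4 → K} (hw : w ∉ ℓ) (hP : P ∈ ℓ) (hR : R ∈ ℓ)
    (hPR : LinearIndependent K ![P, R]) (hPw : differential F P w = 0) :
    differential F R w ≠ 0 := by
  intro hRw
  obtain ⟨V, hV, U, hU, Q, hQw, hVU, hfr⟩ := hS.exists_frame hℓ hF hw
  have key : ∀ X ∈ ℓ, differential F X w = 0 → ∃ t : K, X = t • V := by
    intro X hX hXw
    refine hfr.eq_smul_of_differential_eq_zero hS.one_le hℓ hV hU hVU hX ?_
    have := hF.differential_eq_zero hX hQw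
    rwa [map_sub, hXw, sub_zero] at this
  obtain ⟨t, rfl⟩ := key P hP hPw
  obtain ⟨s, rfl⟩ := key R hR hRw
  rw [LinearIndependent.pair_iff] at hPR
  have h1 := hPR s (-t) (by module)
  have h2 := hPR 1 0 (by rw [neg_eq_zero.mp h1.2]; simp)
  exact one_ne_zero h2.1

lemma differential_ne_zero (hS : IsExtremalSurface F e) (hℓ : IsLine ℓ)
    (hF : VanishesOn F ℓ) {P : Fin 4 → K} (hP : P ∈ ℓ) (hP0 : P ≠ 0) : differential F P ≠ 0 := by
  intro h0
  obtain ⟨R, hR, hPR⟩ := exists_linearIndependent_pair hℓ hP0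
  obtain ⟨w, hw, hwℓ⟩ := exists_mem_ker_notMem (differential F R) hℓ
  exact hS.differential_ne_zero_of_linearIndependent hℓ hF hwℓ hP hR hPR (by rw [h0]; rfl) hw

/-- A plane through a line of the surface cuts out a pencil. -/
lemma exists_isPencil (hS : IsExtremalSurface F e) (hℓ : IsLine ℓ) (hF : VanishesOn F ℓ)
    {H : Submodule K (Fin 4 → K)} (hH : IsPlane H) (hle : ℓ ≤ H) :
    ∃ P, IsPencil F (e + 1) H P := by
  obtain ⟨w, hwH, hwℓ⟩ := exists_mem_notMem (W := ℓ) (W' := H) (by rw [hℓ, hH]; omega)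
  obtain ⟨V, hV, U, hU, Q, hQw, hVU, hfr⟩ := hS.exists_frame hℓ hF hwℓ
  have hQ : Q ∉ ℓ := fun h => hwℓ (by simpa using ℓ.sub_mem h hQw)
  have hQH : Q ∈ H := by simpa using H.add_mem (hle hQw) hwH
  have hV0 : V ≠ 0 := hVU.ne_zero 0
  obtain ⟨a, ha⟩ := Projectivization.exists_smul_eq_mk_rep K V hV0
  exact ⟨Projectivization.mk K V hV0, isPencil_of_isPencilFrame hH (hle hV) (hle hU) hQH
    (linearIndependent_three hV hU hVU hQ) hfr (t := (a : K)) ha.symm⟩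

/-- The tangent plane at a point of a line of the surface cuts out a pencil with that vertex. -/
lemma isPencil_ker_differential (hS : IsExtremalSurface F e) (hℓ : IsLine ℓ) (hF : VanishesOn F ℓ)
    {P : Projectivization K (Fin 4 → K)} (hP : P.rep ∈ ℓ) :
    IsPencil F (e + 1) (LinearMap.ker (differential F P.rep)) P := by
  set H := LinearMap.ker (differential F P.rep) with hHdef
  have hH : IsPlane H := isPlane_ker (hS.differential_ne_zero hℓ hF hP P.rep_nonzero)
  have hle : ℓ ≤ H := fun v hv => hF.differential_eq_zero hP hv
  obtain ⟨w, hwH, hwℓ⟩ := exists_mem_notMem (W := ℓ) (W' := H) (by rw [hℓ, hH]; omega)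
  obtain ⟨V, hV, U, hU, Q, hQw, hVU, hfr⟩ := hS.exists_frame hℓ hF hwℓ
  have hQ : Q ∉ ℓ := fun h => hwℓ (by simpa using ℓ.sub_mem h hQw)
  have hQH : Q ∈ H := by simpa using H.add_mem (hle hQw) hwH
  obtain ⟨t, ht⟩ := hfr.eq_smul_of_differential_eq_zero hS.one_le hℓ hV hU hVU hP hQH
  exact isPencil_of_isPencilFrame hH (hle hV) (hle hU) hQH
    (linearIndependent_three hV hU hVU hQ) hfr ht

/-- Every point of the surface lies on a line of the surface. -/
lemma exists_isLine_mem (hS : IsExtremalSurface F e) {P : Fin 4 → K} (hP : eval P F = 0) :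
    ∃ ℓ, IsLine ℓ ∧ VanishesOn F ℓ ∧ P ∈ ℓ := by
  obtain ⟨ℓ, hℓ, hF⟩ := hS.exists_isLine
  by_cases hPℓ : P ∈ ℓ
  · exact ⟨ℓ, hℓ, hF, hPℓ⟩
  obtain ⟨V, hV, U, hU, Q, hQP, hVU, c, hc, Γ, hΓ, h⟩ := hS.exists_frame hℓ hF hPℓ
  have hV0 : V ≠ 0 := hVU.ne_zero 0
  obtain ⟨x, y, hxy⟩ := exists_eq_of_mem_line hℓ hV hU hVU hQP
  have hPQ : P = (-x) • V + (-y) • U + (1 : K) • Q := by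
    rw [eq_comm, ← sub_eq_zero]
    rw [← sub_eq_zero] at hxy
    rw [← hxy]; module
  have hroot : ∏ γ ∈ Γ, (-y - γ * 1) = 0 := by
    rw [hPQ, eval_of_frame h] at hP
    simpa [hc] using hP
  obtain ⟨γ, hγ, hγy⟩ := Finset.prod_eq_zero_iff.mp hroot
  have hVP : LinearIndependent K ![V, P] := by
    rw [LinearIndependent.pair_iff' hV0]
    rintro a rfl
    exact hPℓ (ℓ.smul_mem _ hV)
  refine ⟨_, isLine_span_pair hVP, vanishesOn_span ?_, Submodule.subset_span (by simp)⟩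
  refine pullback_eq_zero_of_alongLine hS.isHomogeneous ?_
  have h1 := alongLine_pullback (Matrix.of ![V, U, Q]) F ![-x, -y, 1] ![1, 0, 0]
  rw [vecMul_three, vecMul_three] at h1
  simp only [Matrix.cons_val_zero, Matrix.cons_val_one, Matrix.cons_val, one_smul, zero_smul,
    add_zero] at h1
  rw [one_smul] at hPQ
  rw [hPQ, ← h1, h, ← Finset.mul_prod_erase _ _ hγ]
  simp only [alongLine_mul]
  have h2 : alongLine (linForm ![0, 1, -γ]) ![-x, -y, 1] ![1, 0, 0] = 0 := by
    rw [alongLine, aeval_linForm]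
    simp only [Fin.sum_univ_three, Matrix.cons_val_zero, Matrix.cons_val_one, Matrix.cons_val]
    have : γ = -y := by rw [mul_one] at hγy; exact (sub_eq_zero.mp hγy).symm
    simp [this]
  rw [h2]
  ring

end IsExtremalSurface

end Tangent

section Counting

lemma linearIndependent_pair_rep {P P' : Projectivization K (Fin 4 → K)} (h : P ≠ P') :
    LinearIndependent K ![P.rep, P'.rep] := by
  rw [LinearIndependent.pair_iff' P.rep_nonzero]
  intro a ha
  apply h
  rw [← P.mk_rep, ← P'.mk_rep, eq_comm, Projectivization.mk_eq_mk_iff']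
  exact ⟨a, ha⟩

variable [Fintype K]

lemma card_plane_sections_complement {H T : Submodule K (Fin 4 → K)} [DecidablePred (· ∈ H)]
    [DecidablePred (· ∈ T)] (hH : IsPlane H) (hHT : IsLine (H ⊓ T)) :
    (Finset.univ.filter fun v : Fin 4 → K => v ∈ H ∧ v ∉ T).card =
      Fintype.card K ^ 3 - Fintype.card K ^ 2 := by
  classical
  have h1 : (Finset.univ.filter fun v : Fin 4 → K => v ∈ H).card = Fintype.card K ^ 3 := by
    rw [← Fintype.card_subtype, Module.card_eq_pow_finrank (K := K) (V := H), hH]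
  have h2 : (Finset.univ.filter fun v : Fin 4 → K => v ∈ H ∧ v ∈ T).card =
      Fintype.card K ^ 2 := by
    rw [← card_line hHT, Fintype.card_subtype]
    simp only [Submodule.mem_inf]
  have h3 := Finset.card_filter_add_card_filter_not
    (s := Finset.univ.filter fun v : Fin 4 → K => v ∈ H) (· ∈ T)
  rw [Finset.filter_filter, Finset.filter_filter, h1, h2] at h3
  exact Nat.eq_sub_of_add_eq' h3

/-- There are as many planes as points in projective space. -/
lemma card_isPlane : Nat.card {H : Submodule K (Fin 4 → K) // IsPlane H} =
    Fintype.card K ^ 3 + Fintype.card K ^ 2 + Fintype.card K + 1 := by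
  have h1 := Projectivization.card_of_finrank K (Fin 4 → K) (n := 4) (Module.finrank_fin_fun K)
  rw [Nat.card_eq_fintype_card (α := K)] at h1
  simp only [Finset.sum_range_succ, Finset.sum_range_zero, pow_zero, pow_one, zero_add] at h1
  have h2 : Nat.card (Projectivization K (Fin 4 → K)) =
      Nat.card {H : Submodule K (Fin 4 → K) // IsPlane H} := by
    refine Nat.card_eq_of_bijective
      (fun p => ⟨LinearMap.ker (linMap p.rep), isPlane_ker (linMap_ne_zero p.rep_nonzero)⟩) ⟨?_, ?_⟩
    · intro p p' h
      simp only [Subtype.mk.injEq] at h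
      have h3 := mem_span_of_iInf_ker_le_ker (ι := Unit) (L := fun _ => linMap p'.rep)
        (K := linMap p.rep) (by rw [iInf_const, h])
      rw [Set.range_const, Submodule.mem_span_singleton] at h3
      obtain ⟨t, ht⟩ := h3
      rw [← p.mk_rep, ← p'.mk_rep, Projectivization.mk_eq_mk_iff']
      refine ⟨t, ?_⟩
      ext i
      simpa [linMap_apply] using LinearMap.congr_fun ht (Pi.single i 1)
    · rintro ⟨H, hH⟩
      obtain ⟨a, ha, rfl⟩ := exists_eq_ker_linMap hH
      obtain ⟨u, hu⟩ := Projectivization.exists_smul_eq_mk_rep K a ha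
      refine ⟨Projectivization.mk K a ha, Subtype.ext ?_⟩
      ext x
      simp [← hu, LinearMap.mem_ker, linMap_apply, Units.smul_def, smul_dotProduct]
  rw [← h2, h1]
  ring

variable [DecidableEq K] {F : MvPolynomial (Fin 4) K} {e : ℕ}

namespace IsExtremalSurface

lemma ker_differential_eq (hS : IsExtremalSurface F e) {H : Submodule K (Fin 4 → K)}
    (hH : IsPlane H) {P : Projectivization K (Fin 4 → K)} (hP : IsPencil F (e + 1) H P) :
    LinearMap.ker (differential F P.rep) = H := by
  obtain ⟨ℓ, hℓ, hF, hPℓ⟩ := hS.exists_isLine_mem hP.eval_rep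
  refine (Submodule.eq_of_le_of_finrank_eq
    (fun v hv => hP.differential_eq_zero hS.one_le hv) ?_).symm
  rw [hH, isPlane_ker (hS.differential_ne_zero hℓ hF hPℓ P.rep_nonzero)]

/-- The points of the surface correspond to the planes cutting out pencils. -/
lemma card_isPencil (hS : IsExtremalSurface F e) :
    Nat.card {H : Submodule K (Fin 4 → K) // IsPlane H ∧ ∃ P, IsPencil F (e + 1) H P} =
      Nat.card {p : Projectivization K (Fin 4 → K) // eval p.rep F = 0} := by
  have hpen : ∀ p : Projectivization K (Fin 4 → K), eval p.rep F = 0 →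
      IsPlane (LinearMap.ker (differential F p.rep)) ∧
        IsPencil F (e + 1) (LinearMap.ker (differential F p.rep)) p := by
    intro p hp
    obtain ⟨ℓ, hℓ, hF, hPℓ⟩ := hS.exists_isLine_mem hp
    exact ⟨isPlane_ker (hS.differential_ne_zero hℓ hF hPℓ p.rep_nonzero),
      hS.isPencil_ker_differential hℓ hF hPℓ⟩
  refine (Nat.card_eq_of_bijective (fun p => ⟨LinearMap.ker (differential F p.1.rep),
    (hpen p.1 p.2).1, p.1, (hpen p.1 p.2).2⟩) ⟨?_, ?_⟩).symm
  · rintro ⟨P, hP⟩ ⟨P', hP'⟩ h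
    simp only [Subtype.mk.injEq] at h ⊢
    by_contra hne
    have hPP := linearIndependent_pair_rep hne
    have hℓ := isLine_span_pair hPP
    have hP'mem : P'.rep ∈ LinearMap.ker (differential F P.rep) := by
      rw [h]; exact (hpen P' hP').2.rep_mem
    have hF := (hpen P hP).2.vanishesOn hP'mem hP'
    obtain ⟨w, hw, hwℓ⟩ := exists_mem_ker_notMem (differential F P.rep) hℓ
    refine hS.differential_ne_zero_of_linearIndependent hℓ hF hwℓ (Submodule.subset_span (by simp))
      (Submodule.subset_span (by simp)) hPP hw ?_
    rw [← LinearMap.mem_ker, h] at hw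
    exact hw
  · rintro ⟨H, hH, P, hP⟩
    exact ⟨⟨P, hP.eval_rep⟩, Subtype.ext (hS.ker_differential_eq hH hP)⟩

lemma card_isPlane_not_isPencil (hS : IsExtremalSurface F e) :
    Nat.card {H : Submodule K (Fin 4 → K) // IsPlane H ∧ ¬ ∃ P, IsPencil F (e + 1) H P} =
      Fintype.card K ^ 3 + Fintype.card K ^ 2 + Fintype.card K + 1 -
        Nat.card {p : Projectivization K (Fin 4 → K) // eval p.rep F = 0} := by
  classical
  rw [← hS.card_isPencil, ← card_isPlane]
  simp only [Nat.card_eq_fintype_card, Fintype.card_subtype]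
  apply Nat.eq_sub_of_add_eq'
  rw [← Finset.filter_filter, ← Finset.filter_filter]
  exact Finset.card_filter_add_card_filter_not _

/-- Along lines through a point `P` of a line of the surface, not tangent to the surface at `P`,
there are `e` further points of the surface. -/
lemma card_roots (hS : IsExtremalSurface F e) {ℓ : Submodule K (Fin 4 → K)} (hℓ : IsLine ℓ)
    (hF : VanishesOn F ℓ) {P v : Fin 4 → K} (hP : P ∈ ℓ) (hv : differential F P v ≠ 0) :
    (Finset.univ.filter fun t : K => eval (v + t • P) F = 0).card = e := by
  have hvℓ : v ∉ ℓ := fun h => hv (hF.differential_eq_zero hP h)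
  obtain ⟨V, hV, U, hU, Q, hQv, hVU, c, hc, Γ, hΓ, h⟩ := hS.exists_frame hℓ hF hvℓ
  obtain ⟨x, y, hxy⟩ := exists_eq_of_mem_line hℓ hV hU hVU hQv
  have hvQ : v = (-x) • V + (-y) • U + (1 : K) • Q := by
    rw [eq_comm, ← sub_eq_zero]
    rw [← sub_eq_zero] at hxy
    rw [← hxy]; module
  have hD := hF.differential_eq_zero hP hQv
  rw [map_sub, sub_eq_zero] at hD
  obtain ⟨p₀, p₁, rfl⟩ := exists_eq_of_mem_line hℓ hV hU hVU hP
  have hp : p₁ ≠ 0 := by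
    rintro rfl
    apply hv
    rw [← hD, differential_of_frame h, hΓ, zero_pow (by have := hS.one_le; omega), mul_zero]
  rw [hvQ, card_roots_of_frame hc h hp one_ne_zero, hΓ]

/-- A plane containing no line of the surface contains `e q + 1` points of the surface. -/
lemma card_section (hS : IsExtremalSurface F e) {H : Submodule K (Fin 4 → K)} (hH : IsPlane H)
    (hno : ¬ ∃ ℓ ≤ H, IsLine ℓ ∧ VanishesOn F ℓ) :
    Nat.card {p : Projectivization K (Fin 4 → K) // p.rep ∈ H ∧ eval p.rep F = 0} =
      e * Fintype.card K + 1 := by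
  classical
  obtain ⟨ℓ, hℓ, hF⟩ := hS.exists_isLine
  obtain ⟨P, hP, hP0⟩ := exists_mem_notMem (W := (⊥ : Submodule K (Fin 4 → K))) (W' := H ⊓ ℓ) (by
    have h1 := Submodule.finrank_sup_add_finrank_inf_eq H ℓ
    have h2 := Submodule.finrank_le (H ⊔ ℓ)
    rw [hH, hℓ] at h1
    rw [Module.finrank_fin_fun] at h2
    rw [finrank_bot]
    omega)
  rw [Submodule.mem_bot] at hP0
  obtain ⟨u, hu⟩ := Projectivization.exists_smul_eq_mk_rep K P hP0
  set p := Projectivization.mk K P hP0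
  have hp : p.rep ∈ H ⊓ ℓ := by rw [← hu]; exact (H ⊓ ℓ).smul_mem (u : K) hP
  set T := LinearMap.ker (differential F p.rep) with hTdef
  have hT : IsPencil F (e + 1) T p := hS.isPencil_ker_differential hℓ hF hp.2
  have hTplane : IsPlane T := isPlane_ker (hS.differential_ne_zero hℓ hF hp.2 p.rep_nonzero)
  have hℓT : ℓ ≤ T := fun v hv => hF.differential_eq_zero hp.2 hv
  obtain ⟨w, hwH, hwT⟩ : ∃ w ∈ H, w ∉ T := by
    by_contra! hle
    have : H = T := Submodule.eq_of_le_of_finrank_eq hle (by rw [hH, hTplane])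
    exact hno ⟨ℓ, this ▸ hℓT, hℓ, hF⟩
  have hHT : IsLine (H ⊓ T) := isLine_inf_ker hH hwH hwT
  have hcount := card_filter_eq_projectivization (fun v : Fin 4 → K => v ∈ H ∧ eval v F = 0)
    ⟨H.zero_mem, by
      have := eval_smul_of_isHomogeneous hS.isHomogeneous 0 (0 : Fin 4 → K)
      simpa using this⟩ (fun u v => by
      rw [Units.smul_def, eval_smul_of_isHomogeneous hS.isHomogeneous, mul_eq_zero,
        H.smul_mem_iff u.ne_zero]
      simp)
  rw [← Finset.card_filter_add_card_filter_not (· ∈ T), Finset.filter_filter,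
    Finset.filter_filter] at hcount
  have hcT : (Finset.univ.filter fun v : Fin 4 → K => (v ∈ H ∧ eval v F = 0) ∧ v ∈ T).card =
      Fintype.card K := by
    rw [← card_filter_mem_span_singleton p.rep_nonzero]
    congr 1
    ext v
    simp only [Finset.mem_filter, Finset.mem_univ, true_and]
    constructor
    · rintro ⟨⟨hvH, hv⟩, hvT⟩
      by_contra hne
      push Not at hne
      refine hno ⟨_, ?_, isLine_span_pair ((LinearIndependent.pair_iff' p.rep_nonzero).mpr hne),
        hT.vanishesOn hvT hv⟩
      rw [Submodule.span_le]
      rintro x (rfl | rfl)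
      · exact hp.1
      · exact hvH
    · rintro ⟨t, rfl⟩
      exact ⟨⟨H.smul_mem _ hp.1, hF.eval_eq_zero (ℓ.smul_mem _ hp.2)⟩, T.smul_mem _ hT.rep_mem⟩
  have hcN : Fintype.card K *
      (Finset.univ.filter fun v : Fin 4 → K => (v ∈ H ∧ eval v F = 0) ∧ v ∉ T).card =
        (Fintype.card K ^ 3 - Fintype.card K ^ 2) * e := by
    have h1 := card_filter_perm (A := K) (Finset.univ.filter fun v : Fin 4 → K => v ∈ H ∧ v ∉ T)
      (fun t => Equiv.addRight (t • p.rep)) (fun v => eval v F = 0) (by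
        intro t v
        have h2 : t • p.rep ∈ H := H.smul_mem _ hp.1
        have h3 : t • p.rep ∈ T := T.smul_mem _ hT.rep_mem
        simp only [Finset.mem_filter, Finset.mem_univ, true_and, Equiv.coe_addRight]
        rw [H.add_mem_iff_left h2, T.add_mem_iff_left h3])
    rw [Finset.sum_congr rfl (g := fun _ => e), Finset.sum_const,
      card_plane_sections_complement hH hHT, smul_eq_mul, Finset.filter_filter] at h1
    · rw [h1]
      congr 3
      ext v
      tauto
    · intro v hv
      simp only [Finset.mem_filter, Finset.mem_univ, true_and] at hv
      exact hS.card_roots hℓ hF hp.2 hv.2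
  rw [hcT] at hcount
  have hq : 1 < Fintype.card K := Fintype.one_lt_card
  generalize Nat.card {p : Projectivization K (Fin 4 → K) // p.rep ∈ H ∧ eval p.rep F = 0} = N at *
  generalize (Finset.univ.filter fun v : Fin 4 → K => (v ∈ H ∧ eval v F = 0) ∧ v ∉ T).card = M at *
  generalize Fintype.card K = q at *
  obtain ⟨r, rfl⟩ : ∃ r, q = r + 1 := ⟨q - 1, by omega⟩
  rw [Nat.add_sub_cancel] at hcount
  have h1 : (r + 1) ^ 3 - (r + 1) ^ 2 = (r + 1) * ((r + 1) * r) := by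
    rw [Nat.sub_eq_iff_eq_add (Nat.pow_le_pow_right (by omega) (by omega))]; ring
  rw [h1, mul_assoc] at hcN
  have hM := Nat.eq_of_mul_eq_mul_left (by omega) hcN
  rw [hM] at hcount
  apply Nat.eq_of_mul_eq_mul_left (show 0 < r by omega)
  linarith

end IsExtremalSurface

end Counting

/-- Let `S` be a surface of degree `d` (`2 ≤ d ≤ q+1`) in `P^3` over
`F_q` without `F_q`-plane components attaining the elementary bound. Then every `F_q`-plane
section of `S` is either (1) a planar `F_q`-pencil of degree `d`, or (2) a plane curve of
degree `d` without `F_q`-line components having exactly `(d-1)q + 1` points over `F_q`;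
moreover there are exactly `N_q(S)` planes of type (1) and `θ_q(3) - N_q(S)` planes of
type (2). -/
theorem plane_section_dichotomy (K : Type) [Field K] [Fintype K]
    (d : ℕ) (F : MvPolynomial (Fin 4) K)
    (hhom : F.IsHomogeneous d) (hsf : Squarefree F)
    (hnoplane : ¬ ∃ a : Fin 4 → K, a ≠ 0 ∧ linForm a ∣ F)
    (hd2 : 2 ≤ d) (hdq : d ≤ Fintype.card K + 1)
    (hN : Nat.card {p : Projectivization K (Fin 4 → K) // MvPolynomial.eval p.rep F = 0} =
      (d - 1) * Fintype.card K ^ 2 + d * Fintype.card K + 1) :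
    (∀ H : Submodule K (Fin 4 → K), IsPlane H →
      (∃ P, IsPencil F d H P) ∨
      (¬ SectionHasLineComp F H ∧
        Nat.card {p : Projectivization K (Fin 4 → K) //
            p.rep ∈ H ∧ MvPolynomial.eval p.rep F = 0} =
          (d - 1) * Fintype.card K + 1)) ∧
    Nat.card {H : Submodule K (Fin 4 → K) // IsPlane H ∧ ∃ P, IsPencil F d H P} =
      (d - 1) * Fintype.card K ^ 2 + d * Fintype.card K + 1 ∧
    Nat.card {H : Submodule K (Fin 4 → K) // IsPlane H ∧ ¬ ∃ P, IsPencil F d H P} =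
      (Fintype.card K ^ 3 + Fintype.card K ^ 2 + Fintype.card K + 1) -
        ((d - 1) * Fintype.card K ^ 2 + d * Fintype.card K + 1) := by
  classical
  obtain ⟨e, rfl⟩ := Nat.exists_eq_add_of_le' (show 1 ≤ d by omega)
  rw [Nat.add_sub_cancel] at *
  have hS : IsExtremalSurface F e := by
    refine ⟨by omega, by omega, hhom, hnoplane, ?_⟩
    have h1 := card_filter_eq_projectivization (fun v : Fin 4 → K => eval v F = 0)
      (by simpa using eval_smul_of_isHomogeneous hhom 0 (0 : Fin 4 → K)) (fun u v => by
        rw [Units.smul_def, eval_smul_of_isHomogeneous hhom, mul_eq_zero]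
        simp)
    rw [IsExtremal, h1, hN]
    have hq : 1 < Fintype.card K := Fintype.one_lt_card
    obtain ⟨r, hr⟩ : ∃ r, Fintype.card K = r + 1 := ⟨Fintype.card K - 1, by omega⟩
    have h2 : (r + 1) ^ 2 - 1 = r ^ 2 + 2 * r := by
      rw [Nat.sub_eq_iff_eq_add (Nat.one_le_pow _ _ (by omega))]; ring
    rw [hr, h2, Nat.add_sub_cancel]
    ring
  refine ⟨fun H hH => ?_, ?_, ?_⟩
  · by_cases hline : ∃ ℓ ≤ H, IsLine ℓ ∧ VanishesOn F ℓ
    · obtain ⟨ℓ, hle, hℓ, hF⟩ := hline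
      exact Or.inl (hS.exists_isPencil hℓ hF hH hle)
    · exact Or.inr ⟨fun h => hline h.exists_isLine, hS.card_section hH hline⟩
  · rw [hS.card_isPencil, hN]
  · rw [hS.card_isPlane_not_isPencil, hN]
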